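/- arXiv:math/0612117 — 3 statements merged into one kernel-verified Lean document; each statement's English description precedes it below -/
import Mathlib

section
/- Every finite-dimensional real Lie algebra admits a pre-Einstein derivation. -/
open LieAlgebra Module LinearMap

/-- A pre-Einstein derivation: semisimple with all eigenvalues real (i.e. there is a basis of
eigenvectors with real eigenvalues) and `Tr (φ ∘ ψ) = Tr ψ` for every derivation `ψ`. -/
def IsPreEinstein {l : Type*} [LieRing l] [LieAlgebra ℝ l] [FiniteDimensional ℝ l]
    (φ : LieDerivation ℝ l l) : Prop :=
  (∃ (ι : Type) (b : Basis ι ℝ l), ∀ i, ∃ μ : ℝ, φ (b i) = μ • b i) ∧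
  ∀ ψ : LieDerivation ℝ l l,
    trace ℝ l ((φ : l →ₗ[ℝ] l) ∘ₗ (ψ : l →ₗ[ℝ] l)) = trace ℝ l (ψ : l →ₗ[ℝ] l)


/-- Real diagonalizability: the eigenspaces span. -/
def PEDiag {V : Type*} [AddCommGroup V] [Module ℝ V] (f : Module.End ℝ V) : Prop :=
  ⨆ μ, f.eigenspace μ = ⊤

section
set_option linter.unusedSectionVars false
variable {V : Type} [AddCommGroup V] [Module ℝ V] [FiniteDimensional ℝ V]

lemma PEDiag.exists_basis {f : Module.End ℝ V} (hf : PEDiag f) :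
    ∃ (ι : Type) (b : Basis ι ℝ V), ∀ i, ∃ μ : ℝ, f (b i) = μ • b i := by
  have hs : ⊤ ≤ Submodule.span ℝ {v : V | ∃ μ : ℝ, f v = μ • v} := by
    rw [← hf]
    refine iSup_le fun μ v hv => Submodule.subset_span ⟨μ, ?_⟩
    exact Module.End.mem_eigenspace_iff.1 hv
  refine ⟨_, Basis.ofSpan hs, fun i => ?_⟩
  exact Basis.ofSpan_subset hs ⟨i, rfl⟩

lemma PEDiag.of_basis {f : Module.End ℝ V} {ι : Type*} (b : Basis ι ℝ V)
    (h : ∀ i, ∃ μ : ℝ, f (b i) = μ • b i) : PEDiag f := by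
  unfold PEDiag
  rw [eq_top_iff, ← b.span_eq, Submodule.span_le]
  rintro _ ⟨i, rfl⟩
  obtain ⟨μ, hμ⟩ := h i
  exact Submodule.mem_iSup_of_mem μ (Module.End.mem_eigenspace_iff.2 hμ)

lemma PEDiag.smul {f : Module.End ℝ V} (hf : PEDiag f) (c : ℝ) : PEDiag (c • f) := by
  obtain ⟨ι, b, hb⟩ := hf.exists_basis
  refine .of_basis b fun i => ?_
  obtain ⟨μ, hμ⟩ := hb i
  exact ⟨c * μ, by simp [hμ, mul_smul]⟩

lemma PEDiag.one : PEDiag (1 : Module.End ℝ V) :=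
  .of_basis (Basis.ofVectorSpace ℝ V) fun i => ⟨1, by simp⟩

lemma PEDiag.zero : PEDiag (0 : Module.End ℝ V) :=
  .of_basis (Basis.ofVectorSpace ℝ V) fun i => ⟨0, by simp⟩

lemma PEDiag.add {f g : Module.End ℝ V} (hf : PEDiag f) (hg : PEDiag g) (h : Commute f g) :
    PEDiag (f + g) := by
  unfold PEDiag
  rw [eq_top_iff, ← hf]
  refine iSup_le fun a => ?_
  have h1 : ∀ x ∈ f.eigenspace a, g x ∈ f.eigenspace a := by
    intro x hx
    rw [Module.End.mem_eigenspace_iff] at hx ⊢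
    rw [← Module.End.mul_apply, h.eq, Module.End.mul_apply, hx, map_smul]
  rw [Submodule.eq_iSup_inf_genEigenspace 1 h1 hg]
  refine iSup_le fun c x hx => ?_
  have hx1 := Module.End.mem_eigenspace_iff.1 hx.1
  have hx2 := Module.End.mem_eigenspace_iff.1 hx.2
  refine Submodule.mem_iSup_of_mem (a + c) (Module.End.mem_eigenspace_iff.2 ?_)
  rw [LinearMap.add_apply, hx1, hx2, add_smul]

lemma PEDiag.maxGen_le {W : Type*} [AddCommGroup W] [Module ℝ W] [FiniteDimensional ℝ W]
    {f : Module.End ℝ W} (hf : PEDiag f) (μ : ℝ) :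
    f.maxGenEigenspace μ ≤ f.eigenspace μ := by
  have h1 : ∀ x ∈ f.maxGenEigenspace μ, f x ∈ f.maxGenEigenspace μ :=
    Module.End.mapsTo_maxGenEigenspace_of_comm (Commute.refl f) μ
  rw [Submodule.eq_iSup_inf_genEigenspace 1 h1 hf]
  refine iSup_le fun c => ?_
  rcases eq_or_ne μ c with rfl | hc
  · exact inf_le_right
  · rw [(Module.End.disjoint_genEigenspace f hc _ _).eq_bot]
    exact bot_le

/-- The commutator with `t`. -/
def peAd (t : Module.End ℝ V) : Module.End ℝ (Module.End ℝ V) :=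
  LinearMap.mulLeft ℝ t - LinearMap.mulRight ℝ t

lemma PEDiag.ad {t : Module.End ℝ V} (ht : PEDiag t) :
    PEDiag (peAd t) := by
  classical
  obtain ⟨ι, b, hb⟩ := ht.exists_basis
  have : Fintype ι := FiniteDimensional.fintypeBasisIndex b
  choose a ha using hb
  refine .of_basis (b.linearMap b) fun ij => ⟨a ij.1 - a ij.2, ?_⟩
  exact b.lie_end_of_apply_eq_smul a t ha ij.1 ij.2

lemma PEDiag.eq_zero {t : Module.End ℝ V} (ht : PEDiag t) (h : trace ℝ V (t * t) = 0) : t = 0 := by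
  classical
  obtain ⟨ι, b, hb⟩ := ht.exists_basis
  have : Fintype ι := FiniteDimensional.fintypeBasisIndex b
  choose a ha using hb
  have h2 : ∑ i, a i * a i = 0 := by
    rw [← h, LinearMap.trace_eq_matrix_trace ℝ b, Matrix.trace]
    refine Finset.sum_congr rfl fun i _ => ?_
    simp [LinearMap.toMatrix_apply, ha]
  rw [Finset.sum_eq_zero_iff_of_nonneg fun i _ => mul_self_nonneg _] at h2
  refine b.ext fun i => ?_
  rw [ha, mul_self_eq_zero.1 (h2 i (Finset.mem_univ i))]
  simp

theorem pe_abstract (D : Submodule ℝ (Module.End ℝ V))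
    (hL : ∀ f ∈ D, ∀ g ∈ D, f * g - g * f ∈ D)
    (hR : ∀ f ∈ D, ∃ p : Polynomial ℝ, PEDiag (Polynomial.aeval f p) ∧ Polynomial.aeval f p ∈ D ∧
      ∀ g, PEDiag g → Commute g f → trace ℝ V (g * (f - Polynomial.aeval f p)) = 0) :
    ∃ φ ∈ D, PEDiag φ ∧ ∀ ψ ∈ D, trace ℝ V (φ * ψ) = trace ℝ V ψ := by
  let S : Set (Submodule ℝ (Module.End ℝ V)) :=
    {T | T ≤ D ∧ (∀ a ∈ T, PEDiag a) ∧ ∀ a ∈ T, ∀ b ∈ T, Commute a b}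
  have hS : S.Nonempty := by
    refine ⟨⊥, bot_le, ?_, ?_⟩
    · intro a ha
      rw [(Submodule.mem_bot ℝ).1 ha]
      exact .zero
    · intro a ha b hb
      rw [(Submodule.mem_bot ℝ).1 ha]
      exact Commute.zero_left b
  obtain ⟨T, ⟨hTD, hTd, hTc⟩, hmax⟩ :=
    (wellFounded_gt (α := Submodule ℝ (Module.End ℝ V))).has_min S hS
  -- absorb
  have absorb : ∀ r ∈ D, PEDiag r → (∀ t ∈ T, Commute t r) → r ∈ T := by
    intro r hr hrd hrc
    by_contra hrT
    refine hmax (T ⊔ Submodule.span ℝ {r}) ⟨?_, ?_, ?_⟩ ?_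
    · exact sup_le hTD (by simpa using hr)
    · intro a ha
      obtain ⟨t, ht, y, hy, rfl⟩ := Submodule.mem_sup.1 ha
      obtain ⟨c, rfl⟩ := Submodule.mem_span_singleton.1 hy
      exact (hTd t ht).add (hrd.smul c) ((hrc t ht).smul_right c)
    · intro a ha b hb
      obtain ⟨t, ht, y, hy, rfl⟩ := Submodule.mem_sup.1 ha
      obtain ⟨c, rfl⟩ := Submodule.mem_span_singleton.1 hy
      obtain ⟨t', ht', y, hy', rfl⟩ := Submodule.mem_sup.1 hb
      obtain ⟨c', rfl⟩ := Submodule.mem_span_singleton.1 hy'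
      refine Commute.add_left (Commute.add_right (hTc t ht t' ht') ((hrc t ht).smul_right c'))
        (Commute.add_right ((hrc t' ht').symm.smul_left c) ?_)
      exact ((Commute.refl r).smul_left c).smul_right c'
    · refine lt_of_le_of_ne le_sup_left fun h => hrT ?_
      rw [h]
      exact Submodule.mem_sup_right (Submodule.mem_span_singleton_self r)
  -- the trace form
  let tf : Module.End ℝ V →ₗ[ℝ] Module.End ℝ V →ₗ[ℝ] ℝ :=
    (LinearMap.mul ℝ (Module.End ℝ V)).compr₂ (trace ℝ V)
  have htf : ∀ a b, tf a b = trace ℝ V (a * b) := fun a b => rfl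
  let B : T →ₗ[ℝ] Module.Dual ℝ T := tf.domRestrict₁₂ T T
  have hB : Function.Injective B := by
    rw [← LinearMap.ker_eq_bot, LinearMap.ker_eq_bot']
    intro t ht
    have h1 : B t t = 0 := by rw [ht]; rfl
    exact Subtype.ext ((hTd t t.2).eq_zero h1)
  have hBs : Function.Surjective B :=
    (LinearMap.injective_iff_surjective_of_finrank_eq_finrank
      (Subspace.dual_finrank_eq).symm).1 hB
  obtain ⟨φ, hφ⟩ := hBs ((trace ℝ V).domRestrict T)
  have hφT : ∀ t ∈ T, trace ℝ V (φ.1 * t) = trace ℝ V t := fun t ht =>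
    LinearMap.congr_fun hφ ⟨t, ht⟩
  refine ⟨φ, hTD φ.2, hTd _ φ.2, ?_⟩
  -- centralizer
  have cent : ∀ ψ ∈ D, (∀ t ∈ T, Commute t ψ) → trace ℝ V (φ.1 * ψ) = trace ℝ V ψ := by
    intro ψ hψ hc
    obtain ⟨p, hp, hpD, htr⟩ := hR ψ hψ
    have hr := absorb _ hpD hp fun t ht => by
      have := hc t ht
      refine (Algebra.commute_of_mem_adjoin_singleton_of_commute (R := ℝ) ?_ this)
      exact Polynomial.aeval_mem_adjoin_singleton ℝ ψ
    have h1 := htr φ (hTd _ φ.2) (hc _ φ.2)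
    have h2 := htr 1 .one (Commute.one_left _)
    rw [mul_sub, map_sub, sub_eq_zero] at h1 h2
    rw [h1, hφT _ hr, ← one_mul ψ, h2, one_mul]
    simp
  let ad' : T → Module.End ℝ D := fun t =>
    (peAd t.1).restrict (p := D) (q := D)
      fun x hx => hL _ (hTD t.2) _ hx
  have had : ∀ t x, ((ad' t x : D) : Module.End ℝ V) = t.1 * x.1 - x.1 * t.1 := fun t x => rfl
  have hdiag : ∀ t, PEDiag (ad' t) := fun t =>
    Module.End.genEigenspace_restrict_eq_top _ (hTd _ t.2).ad
  have hcomm : ∀ s t, Commute (ad' s) (ad' t) := by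
    intro s t
    refine LinearMap.ext fun x => Subtype.ext ?_
    simp only [Module.End.mul_apply, had]
    have h0 := (hTc _ s.2 _ t.2).eq
    have h1 : s.1 * (t.1 * x.1) = t.1 * (s.1 * x.1) := by rw [← mul_assoc, h0, mul_assoc]
    have h2 : x.1 * (s.1 * t.1) = x.1 * (t.1 * s.1) := by rw [h0]
    simp only [mul_sub, sub_mul, mul_assoc, h1, h2]
    abel
  have htop := Module.End.iSup_iInf_maxGenEigenspace_eq_top_of_iSup_maxGenEigenspace_eq_top_of_commute
    ad' (fun s t _ => hcomm s t) (fun t => by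
      rw [eq_top_iff, ← hdiag t]
      exact iSup_mono fun μ => (ad' t).genEigenspace μ |>.monotone le_top)
  let L : D →ₗ[ℝ] ℝ := (tf (φ.1 - 1)).domRestrict D
  have hLv : ∀ x : D, L x = trace ℝ V ((φ.1 - 1) * x.1) := fun x => rfl
  have hLad : ∀ t x, L (ad' t x) = 0 := by
    intro t x
    rw [hLv, had, mul_sub, map_sub, ← mul_assoc, ← mul_assoc,
      LinearMap.trace_mul_comm ℝ ((φ.1 - 1) * x.1), ← mul_assoc,
      ((hTc _ φ.2 _ t.2).sub_left (Commute.one_left _)).eq, sub_self]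
  have hker : (⊤ : Submodule ℝ D) ≤ LinearMap.ker L := by
    rw [← htop]
    refine iSup_le fun χ x hx => ?_
    rw [Submodule.mem_iInf] at hx
    rw [LinearMap.mem_ker]
    by_cases hχ : ∃ t, χ t ≠ 0
    · obtain ⟨t, ht⟩ := hχ
      have h1 := Module.End.mem_eigenspace_iff.1 ((hdiag t).maxGen_le _ (hx t))
      have h2 := hLad t x
      rw [h1, map_smul, smul_eq_mul] at h2
      exact (mul_eq_zero.1 h2).resolve_left ht
    · push Not at hχ
      rw [hLv, sub_mul, one_mul, map_sub, sub_eq_zero]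
      refine cent _ x.2 fun t ht => ?_
      have h1 := Module.End.mem_eigenspace_iff.1 ((hdiag ⟨t, ht⟩).maxGen_le _ (hx ⟨t, ht⟩))
      rw [hχ, zero_smul] at h1
      have h2 := congrArg Subtype.val h1
      rw [had] at h2
      exact sub_eq_zero.1 h2
  intro ψ hψ
  have := hker (Submodule.mem_top (x := ⟨ψ, hψ⟩))
  rw [LinearMap.mem_ker, hLv, sub_mul, one_mul, map_sub, sub_eq_zero] at this
  exact this
end

section
open Polynomial

lemma pe_re_eq {q : ℝ[X]} (hq : Irreducible q) {μ ν : ℂ} (hμ : aeval μ q = 0)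
    (hν : aeval ν q = 0) : μ.re = ν.re := by
  have h1 := minpoly.eq_of_irreducible hq hμ
  have h2 := minpoly.eq_of_irreducible hq hν
  have h3 : IsConjRoot ℝ μ ν := h1.symm.trans h2
  have : IsAlgClosure ℝ ℂ := ⟨inferInstance, inferInstance⟩
  have : Normal ℝ ℂ := IsAlgClosure.normal ℝ ℂ
  obtain ⟨σ, hσ⟩ := isConjRoot_iff_exists_algEquiv.1 h3
  rcases Complex.real_algHom_eq_id_or_conj σ.toAlgHom with h | h
  · have := DFunLike.congr_fun h ν
    simp only [AlgHom.id_apply] at this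
    rw [← hσ]
    exact congrArg Complex.re this
  · have := DFunLike.congr_fun h ν
    rw [← hσ]
    refine (congrArg Complex.re this).trans ?_
    simp

theorem pe_exists_poly {V : Type} [AddCommGroup V] [Module ℝ V] [FiniteDimensional ℝ V]
    (f : Module.End ℝ V) : ∃ p : ℝ[X], PEDiag (aeval f p) ∧
      ∀ μ : ℂ, ∀ v ∈ Module.End.maxGenEigenspace (f.baseChange ℂ) μ,
        ((aeval f p).baseChange ℂ) v = (μ.re : ℂ) • v := by
  classical
  set M := minpoly ℝ f with hM
  have hint : IsIntegral ℝ f := Algebra.IsIntegral.isIntegral f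
  have hM0 : M ≠ 0 := minpoly.ne_zero hint
  set F := UniqueFactorizationMonoid.normalizedFactors M with hF
  set s : Finset ℝ[X] := F.toFinset with hs
  set n : ℕ := F.card + finrank ℂ (TensorProduct ℝ ℂ V) with hn
  have hirr : ∀ q ∈ s, Irreducible q := fun q hq =>
    UniqueFactorizationMonoid.irreducible_of_normalized_factor q (Multiset.mem_toFinset.1 hq)
  have hnorm : ∀ q ∈ s, normalize q = q := fun q hq =>
    UniqueFactorizationMonoid.normalize_normalized_factor q (Multiset.mem_toFinset.1 hq)
  have hprod : Associated F.prod M := UniqueFactorizationMonoid.prod_normalizedFactors hM0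
  have hdvd : M ∣ ∏ q ∈ s, q ^ n := by
    refine hprod.symm.dvd.trans ?_
    rw [Finset.prod_multiset_count]
    refine Finset.prod_dvd_prod_of_dvd _ _ fun q _ => pow_dvd_pow _ ?_
    exact (Multiset.count_le_card _ _).trans (Nat.le_add_right _ _)
  have hcop : Pairwise (Function.onFun IsCoprime fun q : s => (q : ℝ[X]) ^ n) := by
    intro a b hab
    refine IsCoprime.pow ?_
    rcases (hirr a a.2).isCoprime_or_dvd (b : ℝ[X]) with h | h
    · exact h
    · exfalso
      apply hab
      have := (hirr a a.2).associated_of_dvd (hirr b b.2) h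
      apply Subtype.ext
      rw [← hnorm a a.2, ← hnorm b b.2]
      exact normalize_eq_normalize_iff_associated.2 this
  let r : ℝ[X] → ℝ := fun q => if h : ∃ z : ℂ, aeval z q = 0 then h.choose.re else 0
  have hr : ∀ q ∈ s, ∀ μ : ℂ, aeval μ q = 0 → r q = μ.re := by
    intro q hq μ hμ
    have h : ∃ z : ℂ, aeval z q = 0 := ⟨μ, hμ⟩
    simp only [r, dif_pos h]
    exact pe_re_eq (hirr q hq) h.choose_spec hμ
  obtain ⟨p, hp⟩ := Ideal.exists_forall_sub_mem_ideal
    (I := fun q : s => Ideal.span {(q : ℝ[X]) ^ n})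
    (fun a b hab => (Ideal.isCoprime_span_singleton_iff _ _).2 (hcop hab)) (fun q => C (r q))
  have hp' : ∀ q ∈ s, q ^ n ∣ p - C (r q) := fun q hq =>
    Ideal.mem_span_singleton.1 (hp ⟨q, hq⟩)
  refine ⟨p, ?_, ?_⟩
  · rcases s.eq_empty_or_nonempty with he | hne
    · rw [he, Finset.prod_empty] at hdvd
      have hu : IsUnit M := isUnit_of_dvd_one hdvd
      have : Subsingleton V := by
        by_contra hV
        rw [not_subsingleton_iff_nontrivial] at hV
        exact minpoly.not_isUnit ℝ f hu
      exact Subsingleton.elim _ _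
    · obtain ⟨m, hm⟩ := (exists_sum_eq_one_iff_pairwise_coprime (s := fun q : ℝ[X] => q ^ n) hne).2 hcop
      unfold PEDiag
      rw [eq_top_iff]
      intro v _
      have hv : v = ∑ q ∈ s, aeval f (m q * ∏ j ∈ s \ {q}, j ^ n) v := by
        rw [← LinearMap.sum_apply, ← map_sum, hm, map_one, Module.End.one_apply]
      rw [hv]
      refine Submodule.sum_mem _ fun q hq => Submodule.mem_iSup_of_mem (r q) ?_
      rw [Module.End.mem_eigenspace_iff, ← sub_eq_zero]
      have h1 : aeval f ((p - C (r q)) * (m q * ∏ j ∈ s \ {q}, j ^ n)) = 0 := by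
        have h2 : M ∣ (p - C (r q)) * (m q * ∏ j ∈ s \ {q}, j ^ n) := by
          refine hdvd.trans ?_
          rw [← Finset.mul_prod_erase s _ hq, Finset.erase_eq]
          exact mul_dvd_mul (hp' q hq) (Dvd.intro_left _ rfl)
        obtain ⟨k, hk⟩ := h2
        rw [hk, map_mul, minpoly.aeval, zero_mul]
      have h3 := LinearMap.congr_fun h1 v
      rw [map_mul, map_sub, aeval_C, Module.End.mul_apply, LinearMap.sub_apply,
        Module.algebraMap_end_apply, LinearMap.zero_apply] at h3
      exact h3
  · intro μ v hv
    set g : Module.End ℂ (TensorProduct ℝ ℂ V) := f.baseChange ℂ with hg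
    have hbc : ∀ P : ℝ[X], (aeval f P).baseChange ℂ = aeval g P := fun P =>
      (Polynomial.aeval_algHom_apply (Module.End.baseChangeHom ℝ ℂ V) f P).symm
    rcases eq_or_ne v 0 with rfl | hv0
    · simp
    have hev : g.HasEigenvalue μ := by
      have : g.HasUnifEigenvalue μ ⊤ := fun h => hv0 (by
        have h' : g.maxGenEigenspace μ = ⊥ := h
        rw [h'] at hv; simpa using hv)
      exact this.lt (by simp)
    obtain ⟨w, hw⟩ := hev.exists_hasEigenvector
    have hroot : aeval μ M = 0 := by
      have h1 := Module.End.aeval_apply_of_hasEigenvector (p := M.map (algebraMap ℝ ℂ)) hw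
      rw [aeval_map_algebraMap, ← hbc, minpoly.aeval] at h1
      simp only [LinearMap.baseChange_zero, LinearMap.zero_apply, eval_map_algebraMap] at h1
      exact (smul_eq_zero.1 h1.symm).resolve_right hw.2
    obtain ⟨q, hq, hqμ⟩ : ∃ q ∈ s, aeval μ q = 0 := by
      obtain ⟨k, hk⟩ := hdvd
      have h1 := congrArg (aeval μ) hk
      rw [map_mul, hroot, zero_mul, map_prod, Finset.prod_eq_zero_iff] at h1
      obtain ⟨q, hq, h2⟩ := h1
      rw [map_pow] at h2
      exact ⟨q, hq, eq_zero_of_pow_eq_zero h2⟩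
    obtain ⟨k, hk⟩ := hp' q hq
    have hX : (X - C μ) ^ n ∣ (p - C (r q)).map (algebraMap ℝ ℂ) := by
      rw [hk, Polynomial.map_mul, Polynomial.map_pow]
      refine Dvd.dvd.mul_right (pow_dvd_pow_of_dvd ?_ n) _
      rw [dvd_iff_isRoot, IsRoot.def, eval_map_algebraMap]
      exact hqμ
    obtain ⟨k', hk'⟩ := hX
    have h0 : aeval g ((p - C (r q)).map (algebraMap ℝ ℂ)) v = 0 := by
      rw [hk', mul_comm, map_mul, Module.End.mul_apply]
      have : aeval g ((X - C μ) ^ n) v = 0 := by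
        rw [Module.End.maxGenEigenspace_eq_genEigenspace_finrank,
          Module.End.mem_genEigenspace_nat, LinearMap.mem_ker] at hv
        rw [map_pow, map_sub, aeval_X, aeval_C, hn, pow_add, Module.End.mul_apply,
          Algebra.algebraMap_eq_smul_one, hv, map_zero]
      rw [this, map_zero]
    rw [aeval_map_algebraMap, map_sub, aeval_C, LinearMap.sub_apply, sub_eq_zero, hr q hq μ hqμ] at h0
    rw [hbc, h0, IsScalarTower.algebraMap_apply ℝ ℂ, Module.algebraMap_end_apply]
    rfl

end

section
open Polynomial

lemma pe_trace_zero {V : Type} [AddCommGroup V] [Module ℝ V] [FiniteDimensional ℝ V]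
    (k : Module.End ℝ V)
    (h : ∀ z : ℂ, Module.End.HasEigenvalue (k.baseChange ℂ) z → z.re = 0) : trace ℝ V k = 0 := by
  have h1 := LinearMap.trace_baseChange k ℂ
  have h2 := Module.End.trace_eq_sum_roots_charpoly_of_splits
    (IsAlgClosed.splits (LinearMap.charpoly (k.baseChange ℂ)))
  rw [h1] at h2
  have h3 := congrArg Complex.reAddGroupHom h2
  rw [map_multiset_sum] at h3
  have h4 : (Multiset.map Complex.reAddGroupHom
      (LinearMap.charpoly (k.baseChange ℂ)).roots).sum = 0 := by
    refine Multiset.sum_eq_zero fun x hx => ?_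
    obtain ⟨z, hz, rfl⟩ := Multiset.mem_map.1 hx
    exact h z (Module.End.hasEigenvalue_iff_isRoot_charpoly _ _ |>.2 (isRoot_of_mem_roots hz))
  rw [h4] at h3
  simpa using h3

lemma pe_inv_eig {W : Type} [AddCommGroup W] [Module ℂ W] [FiniteDimensional ℂ W]
    (f : Module.End ℂ W) (P : Submodule ℂ W) (hP : P ≠ ⊥) (h : ∀ x ∈ P, f x ∈ P) :
    ∃ μ, P ⊓ f.eigenspace μ ≠ ⊥ := by
  have : Nontrivial P := Submodule.nontrivial_iff_ne_bot.2 hP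
  obtain ⟨μ, hμ⟩ := Module.End.exists_eigenvalue (f.restrict h)
  obtain ⟨v, hv⟩ := hμ.exists_hasEigenvector
  refine ⟨μ, (Submodule.ne_bot_iff _).2 ⟨v, ⟨v.2, ?_⟩, fun h0 => hv.2 (Subtype.ext h0)⟩⟩
  have := congrArg Subtype.val hv.apply_eq_smul
  exact Module.End.mem_eigenspace_iff.2 this

lemma PEDiag.real_eig {V : Type} [AddCommGroup V] [Module ℝ V] [FiniteDimensional ℝ V]
    {g : Module.End ℝ V} (hg : PEDiag g) {γ : ℂ} {v : TensorProduct ℝ ℂ V} (hv : v ≠ 0)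
    (h : g.baseChange ℂ v = γ • v) : γ.im = 0 := by
  obtain ⟨ι, b, hb⟩ := hg.exists_basis
  choose a ha using hb
  let c := b.baseChange ℂ
  have hc : ∃ i, c.repr v i ≠ 0 := by
    by_contra hcon
    push Not at hcon
    exact hv (c.repr.map_eq_zero_iff.1 (Finsupp.ext hcon))
  obtain ⟨i, hi⟩ := hc
  have h1 : c.coord i ∘ₗ g.baseChange ℂ = (a i : ℂ) • c.coord i := by
    refine c.ext fun j => ?_
    have : g.baseChange ℂ (c j) = (a j : ℂ) • c j := by
      simp only [c, Basis.baseChange_apply, LinearMap.baseChange_tmul, ha,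
        TensorProduct.tmul_smul, TensorProduct.smul_tmul']
      simp
    rw [LinearMap.comp_apply, this]
    rcases eq_or_ne i j with rfl | hij
    · simp
    · simp [hij.symm]
  have h2 := LinearMap.congr_fun h1 v
  rw [LinearMap.comp_apply, h, map_smul, LinearMap.smul_apply, smul_eq_mul, smul_eq_mul] at h2
  rw [mul_right_cancel₀ hi h2]
  simp

lemma pe_trace {V : Type} [AddCommGroup V] [Module ℝ V] [FiniteDimensional ℝ V]
    (f : Module.End ℝ V) (p : ℝ[X])
    (hp : ∀ μ : ℂ, ∀ v ∈ Module.End.maxGenEigenspace (f.baseChange ℂ) μ,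
        ((aeval f p).baseChange ℂ) v = (μ.re : ℂ) • v)
    (g : Module.End ℝ V) (hg : PEDiag g) (hc : Commute g f) :
    trace ℝ V (g * (f - aeval f p)) = 0 := by
  refine pe_trace_zero _ fun z hz => ?_
  set r := aeval f p with hr
  have hgr : Commute g r :=
    Algebra.commute_of_mem_adjoin_singleton_of_commute (R := ℝ)
      (Polynomial.aeval_mem_adjoin_singleton ℝ f) hc
  have hfr : Commute f r :=
    Algebra.commute_of_mem_adjoin_singleton_of_commute (R := ℝ)
      (Polynomial.aeval_mem_adjoin_singleton ℝ f) (Commute.refl f)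
  set β := Module.End.baseChangeHom ℝ ℂ V with hβ
  have hkf : Commute (g * (f - r)) f := hc.mul_left ((Commute.refl f).sub_left hfr.symm)
  have hkg : Commute (g * (f - r)) g := (Commute.refl g).mul_left (hc.symm.sub_left hgr.symm)
  have key : ∀ a b : Module.End ℝ V, Commute a b → ∀ c : ℂ, ∀ x ∈ (β a).eigenspace c,
      β b x ∈ (β a).eigenspace c := by
    intro a b hab c x hx
    rw [Module.End.mem_eigenspace_iff] at hx ⊢
    rw [← Module.End.mul_apply, (hab.map β).eq, Module.End.mul_apply, hx, map_smul]
  have hE : (β (g * (f - r))).eigenspace z ≠ ⊥ := hz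
  obtain ⟨μ, hμ⟩ := pe_inv_eig (β f) _ hE (key _ _ hkf z)
  obtain ⟨γ, hγ⟩ := pe_inv_eig (β g) _ hμ
    (fun x hx => ⟨key _ _ hkg z x hx.1, key _ _ hc.symm μ x hx.2⟩)
  obtain ⟨v, ⟨⟨hv1, hv2⟩, hv3⟩, hv0⟩ := (Submodule.ne_bot_iff _).1 hγ
  have hrv : β r v = (μ.re : ℂ) • v :=
    hp μ v (((β f).genEigenspace μ).monotone le_top hv2)
  replace hv1 := Module.End.mem_eigenspace_iff.1 hv1
  replace hv2 := Module.End.mem_eigenspace_iff.1 hv2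
  replace hv3 := Module.End.mem_eigenspace_iff.1 hv3
  have hγr : γ.im = 0 := hg.real_eig hv0 hv3
  rw [map_mul, map_sub, Module.End.mul_apply, LinearMap.sub_apply, hv2, hrv, map_sub, map_smul,
    map_smul, hv3, smul_smul, smul_smul, ← sub_smul] at hv1
  have := smul_left_injective ℂ hv0 hv1
  rw [← this]
  simp [hγr]

lemma pe_lie_mem {L : Type*} [LieRing L] [LieAlgebra ℂ L] (d : Module.End ℂ L)
    (hd : ∀ x y, d ⁅x, y⁆ = ⁅d x, y⁆ + ⁅x, d y⁆) (a b : ℂ) :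
    ∀ n k₁ k₂ : ℕ, k₁ + k₂ ≤ n → ∀ x y : L, ((d - a • (1 : Module.End ℂ L)) ^ k₁) x = 0 →
      ((d - b • (1 : Module.End ℂ L)) ^ k₂) y = 0 →
      ∃ k : ℕ, ((d - (a + b) • (1 : Module.End ℂ L)) ^ k) ⁅x, y⁆ = 0 := by
  intro n
  induction n with
  | zero =>
    intro k₁ k₂ h x y hx hy
    obtain rfl : k₁ = 0 := by omega
    have : x = 0 := by simpa using hx
    exact ⟨0, by simp [this]⟩
  | succ n ih =>
    intro k₁ k₂ h x y hx hy
    rcases k₁ with _ | k₁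
    · have : x = 0 := by simpa using hx
      exact ⟨0, by simp [this]⟩
    rcases k₂ with _ | k₂
    · have : y = 0 := by simpa using hy
      exact ⟨0, by simp [this]⟩
    have e : (d - (a + b) • (1 : Module.End ℂ L)) ⁅x, y⁆ =
        ⁅(d - a • (1 : Module.End ℂ L)) x, y⁆ + ⁅x, (d - b • (1 : Module.End ℂ L)) y⁆ := by
      simp only [LinearMap.sub_apply, LinearMap.smul_apply, Module.End.one_apply, hd, sub_lie,
        lie_sub, smul_lie, lie_smul, add_smul, LinearMap.add_apply]
      abel
    obtain ⟨m₁, h₁⟩ := ih k₁ (k₂ + 1) (by omega) _ y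
      (by rw [← Module.End.mul_apply, ← pow_succ]; exact hx) hy
    obtain ⟨m₂, h₂⟩ := ih (k₁ + 1) k₂ (by omega) x _ hx
      (by rw [← Module.End.mul_apply, ← pow_succ]; exact hy)
    refine ⟨max m₁ m₂ + 1, ?_⟩
    rw [pow_succ, Module.End.mul_apply, e, map_add,
      Module.End.pow_map_zero_of_le (le_max_left m₁ m₂) h₁,
      Module.End.pow_map_zero_of_le (le_max_right m₁ m₂) h₂, add_zero]

/-- The Leibniz rule for a map of a Lie ring. -/
def PEDer {L : Type*} [LieRing L] (d : L → L) : Prop :=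
  ∀ x y, d ⁅x, y⁆ = ⁅d x, y⁆ + ⁅x, d y⁆

lemma pe_der_complex {L : Type*} [LieRing L] [LieAlgebra ℂ L] [FiniteDimensional ℂ L]
    (d R : Module.End ℂ L) (hder : PEDer d)
    (hp : ∀ μ : ℂ, ∀ v ∈ d.maxGenEigenspace μ, R v = (μ.re : ℂ) • v) : PEDer R := by
  have htop := Module.End.iSup_maxGenEigenspace_eq_top d
  intro x y
  have hx : x ∈ ⨆ μ, d.maxGenEigenspace μ := htop ▸ Submodule.mem_top
  have hy : y ∈ ⨆ μ, d.maxGenEigenspace μ := htop ▸ Submodule.mem_top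
  induction hx using Submodule.iSup_induction' with
  | zero => simp
  | add x x' _ _ hx hx' => simp only [add_lie, map_add, hx, hx']; abel
  | mem a x hx =>
    induction hy using Submodule.iSup_induction' with
    | zero => simp
    | add y y' _ _ hy hy' => simp only [lie_add, map_add, hy, hy']; abel
    | mem b y hy =>
      rw [hp a x hx, hp b y hy]
      obtain ⟨k₁, h₁⟩ := (Module.End.mem_maxGenEigenspace _ _ _).1 hx
      obtain ⟨k₂, h₂⟩ := (Module.End.mem_maxGenEigenspace _ _ _).1 hy
      have := (Module.End.mem_maxGenEigenspace _ _ _).2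
        (pe_lie_mem d hder a b _ k₁ k₂ le_rfl x y h₁ h₂)
      rw [hp _ _ this, smul_lie, lie_smul, ← add_smul, Complex.add_re, Complex.ofReal_add]

lemma pe_der {l : Type} [LieRing l] [LieAlgebra ℝ l] [FiniteDimensional ℝ l]
    (f r : Module.End ℝ l) (hf : ∀ x y, f ⁅x, y⁆ = ⁅f x, y⁆ + ⁅x, f y⁆)
    (hp : ∀ μ : ℂ, ∀ v ∈ Module.End.maxGenEigenspace (f.baseChange ℂ) μ,
        (r.baseChange ℂ) v = (μ.re : ℂ) • v) :
    ∀ x y, r ⁅x, y⁆ = ⁅r x, y⁆ + ⁅x, r y⁆ := by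
  have hder : PEDer (f.baseChange ℂ) := by
    intro x y
    induction x with
    | zero => simp
    | add x x' hx hx' => simp only [add_lie, map_add, hx, hx']; abel
    | tmul a x =>
      induction y with
      | zero => rw [map_zero, lie_zero, lie_zero, map_zero, add_zero]
      | add y y' hy hy' => simp only [lie_add, map_add, hy, hy']; abel
      | tmul b y =>
        change (f.baseChange ℂ) ((a * b) ⊗ₜ[ℝ] ⁅x, y⁆) =
          (a * b) ⊗ₜ[ℝ] ⁅f x, y⁆ + (a * b) ⊗ₜ[ℝ] ⁅x, f y⁆
        rw [LinearMap.baseChange_tmul, hf, TensorProduct.tmul_add]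
  have hRder := pe_der_complex _ _ hder hp
  intro x y
  have h := hRder (1 ⊗ₜ[ℝ] x) (1 ⊗ₜ[ℝ] y)
  change (r.baseChange ℂ) (((1 : ℂ) * 1) ⊗ₜ[ℝ] ⁅x, y⁆) =
          ((1 : ℂ) * 1) ⊗ₜ[ℝ] ⁅r x, y⁆ + ((1 : ℂ) * 1) ⊗ₜ[ℝ] ⁅x, r y⁆ at h
  rw [LinearMap.baseChange_tmul, ← TensorProduct.tmul_add, mul_one] at h
  exact Module.FaithfullyFlat.tensorProduct_mk_injective (A := ℝ) (B := ℂ) l h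

end

/-- Every finite-dimensional real Lie algebra admits a pre-Einstein derivation. -/
theorem exists_preEinstein (l : Type) [LieRing l] [LieAlgebra ℝ l] [FiniteDimensional ℝ l] :
    ∃ φ : LieDerivation ℝ l l, IsPreEinstein φ := by
  let D : Submodule ℝ (Module.End ℝ l) :=
    { carrier := {f | ∀ x y, f ⁅x, y⁆ = ⁅f x, y⁆ + ⁅x, f y⁆}
      add_mem' := by
        intro f g hf hg x y
        simp only [LinearMap.add_apply, hf x y, hg x y, add_lie, lie_add]
        abel
      zero_mem' := by intro x y; simp
      smul_mem' := by
        intro c f hf x y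
        simp only [LinearMap.smul_apply, hf x y, smul_add, smul_lie, lie_smul] }
  have hD : ∀ f, f ∈ D ↔ ∀ x y, f ⁅x, y⁆ = ⁅f x, y⁆ + ⁅x, f y⁆ := fun f => Iff.rfl
  obtain ⟨φ, hφD, hφ, htr⟩ := pe_abstract D
    (by
      intro f hf g hg
      rw [hD] at hf hg ⊢
      intro x y
      simp only [LinearMap.sub_apply, Module.End.mul_apply, hf, hg, map_add, sub_lie, lie_sub]
      abel)
    (by
      intro f hf
      obtain ⟨p, hp, hv⟩ := pe_exists_poly f
      exact ⟨p, hp, pe_der f _ hf hv, pe_trace f p hv⟩)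
  refine ⟨⟨φ, fun x y => ?_⟩, hφ.exists_basis, fun ψ => ?_⟩
  · rw [(hD φ).1 hφD x y, ← lie_skew y (φ x)]
    abel
  · refine htr ψ ((hD _).2 fun x y => ?_)
    exact (LieDerivation.apply_lie_eq_add ψ x y).trans (add_comm _ _)
end

section
/- If φ1 and φ2 are pre-Einstein derivations of a finite-dimensional real Lie algebra l, then there exists a Lie algebra automorphism σ of l such that φ2 = σ ∘ φ1 ∘ σ⁻¹. -/
open LieAlgebra Module LinearMap

open scoped TensorProduct

/-- Generalized eigenvectors of a derivation multiply. -/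
lemma pe_lie_mem_maxGen {L : Type*} [LieRing L] [LieAlgebra ℂ L] (D : L →ₗ[ℂ] L)
    (hD : ∀ x y, D ⁅x, y⁆ = ⁅D x, y⁆ + ⁅x, D y⁆) (a b : ℂ) (x y : L)
    (hx : x ∈ Module.End.maxGenEigenspace D a) (hy : y ∈ Module.End.maxGenEigenspace D b) :
    ⁅x, y⁆ ∈ Module.End.maxGenEigenspace D (a + b) := by
  rw [Module.End.mem_maxGenEigenspace] at hx hy
  obtain ⟨m, hm⟩ := hx
  obtain ⟨n, hn⟩ := hy
  induction h : m + n generalizing m n x y with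
  | zero =>
    obtain ⟨rfl, rfl⟩ : m = 0 ∧ n = 0 := by omega
    have : x = 0 := by simpa using hm
    simp [this]
  | succ N ih =>
    rcases m with _ | m
    · have : x = 0 := by simpa using hm
      simp [this]
    rcases n with _ | n
    · have : y = 0 := by simpa using hn
      simp [this]
    have h1 := ih ((D - a • (1 : Module.End ℂ L)) x) y m
      (by rw [pow_succ] at hm; exact hm) (n + 1) hn (by omega)
    have h2 := ih x ((D - b • (1 : Module.End ℂ L)) y) (m + 1) hm n
      (by rw [pow_succ] at hn; exact hn) (by omega)
    have h3 := add_mem h1 h2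
    have h4 : ⁅(D - a • (1 : Module.End ℂ L)) x, y⁆ + ⁅x, (D - b • (1 : Module.End ℂ L)) y⁆
        = (D - (a + b) • (1 : Module.End ℂ L)) ⁅x, y⁆ := by
      simp [hD, add_smul]
      abel
    rw [h4, Module.End.mem_maxGenEigenspace] at h3
    obtain ⟨k, hk⟩ := h3
    rw [Module.End.mem_maxGenEigenspace]
    exact ⟨k + 1, by rw [pow_succ]; exact hk⟩

/-- Over `ℂ`, a derivation trace-orthogonal to all derivations is nilpotent. -/
lemma pe_complex {L : Type*} [LieRing L] [LieAlgebra ℂ L] [FiniteDimensional ℂ L] (D : L →ₗ[ℂ] L)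
    (hD : ∀ x y, D ⁅x, y⁆ = ⁅D x, y⁆ + ⁅x, D y⁆)
    (hT : ∀ E : L →ₗ[ℂ] L, (∀ x y, E ⁅x, y⁆ = ⁅E x, y⁆ + ⁅x, E y⁆) → (trace ℂ L (E ∘ₗ D)).re = 0) :
    IsNilpotent (D : Module.End ℂ L) := by
  classical
  let A : ℂ → Submodule ℂ L := fun μ => Module.End.maxGenEigenspace D μ
  have hind : iSupIndep A := Module.End.independent_maxGenEigenspace D
  have htop : ⨆ μ, A μ = ⊤ := Module.End.iSup_maxGenEigenspace_eq_top D
  have hds : DirectSum.IsInternal A :=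
    DirectSum.isInternal_submodule_of_iSupIndep_of_iSup_eq_top hind htop
  have hfin : {μ | A μ ≠ ⊥}.Finite := WellFoundedGT.finite_ne_bot_of_iSupIndep hind
  let e := LinearEquiv.ofBijective (DirectSum.coeLinearMap A) hds
  let E : L →ₗ[ℂ] L := (DirectSum.toModule ℂ ℂ L
    (fun μ => (starRingEnd ℂ μ) • (A μ).subtype)) ∘ₗ e.symm.toLinearMap
  have hE : ∀ μ, ∀ x ∈ A μ, E x = (starRingEnd ℂ μ) • x := by
    intro μ x hx
    have : e.symm x = DirectSum.lof ℂ ℂ (fun μ => A μ) μ ⟨x, hx⟩ := by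
      rw [LinearEquiv.symm_apply_eq]
      exact (DirectSum.coeLinearMap_lof A μ ⟨x, hx⟩).symm
    simp [E, this]
  have hind2 : ∀ p : L → Prop, (∀ μ, ∀ x ∈ A μ, p x) → p 0 → (∀ x y, p x → p y → p (x + y)) →
      ∀ x, p x := by
    intro p h1 h2 h3 x
    exact Submodule.iSup_induction A (motive := p) (htop ▸ Submodule.mem_top) h1 h2 h3
  have hEder : ∀ x y, E ⁅x, y⁆ = ⁅E x, y⁆ + ⁅x, E y⁆ := by
    intro x y
    refine hind2 (fun x => E ⁅x, y⁆ = ⁅E x, y⁆ + ⁅x, E y⁆) ?_ (by simp) ?_ x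
    · intro μ x hx
      refine hind2 (fun y => E ⁅x, y⁆ = ⁅E x, y⁆ + ⁅x, E y⁆) ?_ (by simp) ?_ y
      · intro ν y hy
        rw [hE _ _ (pe_lie_mem_maxGen D hD μ ν x y hx hy), hE _ _ hx, hE _ _ hy]
        simp [add_smul]
      · intro y z h1 h2
        simp only [lie_add, map_add, h1, h2]; abel
    · intro x z h1 h2
      simp only [add_lie, map_add, h1, h2]; abel
  have hDm : ∀ μ, Set.MapsTo D (A μ) (A μ) :=
    fun μ => Module.End.mapsTo_maxGenEigenspace_of_comm (Commute.refl D) μ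
  have hEm : ∀ μ, Set.MapsTo E (A μ) (A μ) := fun μ x hx => by
    rw [SetLike.mem_coe, hE μ x hx]; exact Submodule.smul_mem _ _ hx
  have hm : ∀ μ, Set.MapsTo (E ∘ₗ D) (A μ) (A μ) := fun μ => (hEm μ).comp (hDm μ)
  have htr := hT E hEder
  rw [LinearMap.trace_eq_sum_trace_restrict' hds hfin hm] at htr
  have key : ∀ μ, trace ℂ (A μ) ((E ∘ₗ D).restrict (hm μ))
      = ((Complex.normSq μ * (Module.finrank ℂ (A μ) : ℝ) : ℝ) : ℂ) := by
    intro μ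
    have h1 : E.restrict (hEm μ) = (starRingEnd ℂ μ) • LinearMap.id := by
      ext x
      exact hE μ x x.2
    have hn : IsNilpotent ((D.restrict (hDm μ) : Module.End ℂ (A μ)) - algebraMap ℂ _ μ) :=
      Module.End.isNilpotent_restrict_maxGenEigenspace_sub_algebraMap D μ
    rw [LinearMap.restrict_comp (hDm μ) (hEm μ), h1,
      LinearMap.trace_comp_eq_mul_of_commute_of_isNilpotent μ _ hn]
    · simp [← mul_assoc, Complex.mul_conj]
    · ext x; simp
  simp only [key, ← Complex.ofReal_sum, Complex.ofReal_re] at htr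
  rw [Finset.sum_eq_zero_iff_of_nonneg
    (fun i _ => mul_nonneg (Complex.normSq_nonneg i) (Nat.cast_nonneg _))] at htr
  have hz : ∀ μ, A μ ≤ A 0 := by
    intro μ
    by_cases h : A μ = ⊥
    · rw [h]; exact bot_le
    · have h0 := htr μ (by simpa using h)
      have : (Module.finrank ℂ (A μ) : ℝ) ≠ 0 := by
        rw [Nat.cast_ne_zero]
        exact fun h' => h (Submodule.finrank_eq_zero.mp h')
      have : μ = 0 := by simpa [this] using h0
      rw [this]
  have hA0 : A 0 = ⊤ := by
    rw [eq_top_iff, ← htop]; exact iSup_le hz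
  rw [Module.End.isNilpotent_iff_of_finite]
  intro x
  have : x ∈ A 0 := hA0 ▸ Submodule.mem_top
  have := (Module.End.mem_maxGenEigenspace D 0 x).mp this
  simpa using this

/-- Real part `ℂ ⊗ l → l`. -/
noncomputable def peRe (l : Type) [AddCommGroup l] [Module ℝ l] : (ℂ ⊗[ℝ] l) →ₗ[ℝ] l :=
  (TensorProduct.lid ℝ l).toLinearMap ∘ₗ LinearMap.rTensor l Complex.reLm

lemma peRe_tmul (l : Type) [AddCommGroup l] [Module ℝ l] (z : ℂ) (x : l) :
    peRe l (z ⊗ₜ x) = z.re • x := by simp [peRe]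

/-- A real derivation trace-orthogonal to all derivations is nilpotent. -/
lemma pe_real {l : Type} [LieRing l] [LieAlgebra ℝ l] [FiniteDimensional ℝ l]
    (D : LieDerivation ℝ l l)
    (hT : ∀ ψ : LieDerivation ℝ l l, trace ℝ l ((D : l →ₗ[ℝ] l) ∘ₗ (ψ : l →ₗ[ℝ] l)) = 0) :
    IsNilpotent ((D : l →ₗ[ℝ] l) : Module.End ℝ l) := by
  let DC : (ℂ ⊗[ℝ] l) →ₗ[ℂ] (ℂ ⊗[ℝ] l) := LinearMap.baseChange ℂ (D : l →ₗ[ℝ] l)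
  have hDt : ∀ (z : ℂ) (x : l), DC (z ⊗ₜ x) = z ⊗ₜ D x := fun z x => by
    simp [DC]
  have hN : IsNilpotent (DC : Module.End ℂ (ℂ ⊗[ℝ] l)) := by
    apply pe_complex
    · intro x y
      induction x with
      | zero => simp
      | add x x' h h' => simp only [add_lie, map_add, h, h']; abel
      | tmul z x =>
        induction y with
        | zero => simp
        | add x x' h h' => simp only [lie_add, map_add, h, h']; abel
        | tmul w y =>
          simp only [LieAlgebra.ExtendScalars.bracket_tmul, hDt, LieDerivation.apply_lie_eq_add,
            TensorProduct.tmul_add]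
          abel
    · intro E hE
      have hl : ∀ (z : ℂ ⊗[ℝ] l) (y : l), peRe l ⁅z, (1 : ℂ) ⊗ₜ[ℝ] y⁆ = ⁅peRe l z, y⁆ := by
        intro z y
        induction z with
        | zero => simp
        | add x x' h h' => simp only [add_lie, map_add, h, h']
        | tmul w x => simp [LieAlgebra.ExtendScalars.bracket_tmul, peRe_tmul]
      have hr : ∀ (z : ℂ ⊗[ℝ] l) (y : l), peRe l ⁅(1 : ℂ) ⊗ₜ[ℝ] y, z⁆ = ⁅y, peRe l z⁆ := by
        intro z y
        rw [← lie_skew, map_neg, hl, lie_skew]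
      have hsm : ∀ (r : ℝ) (z : ℂ ⊗[ℝ] l), peRe l ((r : ℂ) • z) = r • peRe l z := by
        intro r z
        induction z with
        | zero => simp
        | add x x' h h' => simp only [smul_add, map_add, h, h']
        | tmul w x => simp [TensorProduct.smul_tmul', peRe_tmul, mul_smul]
      let ψ : LieDerivation ℝ l l :=
        { toFun := fun x => peRe l (E ((1 : ℂ) ⊗ₜ x))
          map_add' := fun x y => by simp [TensorProduct.tmul_add]
          map_smul' := fun r x => by
            have : (1 : ℂ) ⊗ₜ[ℝ] (r • x) = (r : ℂ) • ((1 : ℂ) ⊗ₜ[ℝ] x) := by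
              rw [TensorProduct.smul_tmul', ← TensorProduct.smul_tmul]; simp
            rw [this, LinearMap.map_smul E, hsm, RingHom.id_apply]
          leibniz' := fun a b => by
            have h : (1 : ℂ) ⊗ₜ[ℝ] ⁅a, b⁆ = ⁅(1 : ℂ) ⊗ₜ[ℝ] a, (1 : ℂ) ⊗ₜ[ℝ] b⁆ := by
              simp [LieAlgebra.ExtendScalars.bracket_tmul]
            change peRe l (E ((1 : ℂ) ⊗ₜ ⁅a, b⁆)) = ⁅a, peRe l (E ((1 : ℂ) ⊗ₜ b))⁆ -
              ⁅b, peRe l (E ((1 : ℂ) ⊗ₜ a))⁆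
            rw [h, hE, map_add, hl, hr, ← lie_skew b]
            abel }
      have h0 := hT ψ
      rw [LinearMap.trace_comp_comm'] at h0
      let b := Module.finBasis ℝ l
      rw [← h0, LinearMap.trace_eq_matrix_trace ℂ (b.baseChange ℂ),
        LinearMap.trace_eq_matrix_trace ℝ b]
      simp only [Matrix.trace, Matrix.diag, LinearMap.toMatrix_apply, Complex.re_sum]
      refine Finset.sum_congr rfl fun i _ => ?_
      have hc : ∀ z : ℂ ⊗[ℝ] l, ((b.baseChange ℂ).repr z i).re = b.repr (peRe l z) i := by
        intro z
        induction z with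
        | zero => simp
        | add x x' h h' => simp [h, h']
        | tmul w x => simp [peRe_tmul, mul_comm]
      rw [hc]
      congr 1
      simp [hDt]
      rfl
  obtain ⟨n, hn⟩ := hN
  refine ⟨n, ?_⟩
  ext x
  have h1 : ∀ k : ℕ, ∀ x : l, (DC ^ k) ((1 : ℂ) ⊗ₜ x) = (1 : ℂ) ⊗ₜ (((D : l →ₗ[ℝ] l) ^ k) x) := by
    intro k
    induction k with
    | zero => simp
    | succ k ih => intro x; rw [pow_succ, pow_succ, Module.End.mul_apply, hDt, ih]; rfl
  have h2 := congrArg (peRe l) (h1 n x)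
  rw [hn] at h2
  simpa [peRe_tmul] using h2.symm

section pePart
set_option linter.unusedSectionVars false
attribute [local instance] LieRing.ofAssociativeRing
variable {l : Type} [LieRing l] [LieAlgebra ℝ l] [FiniteDimensional ℝ l]

/-- The radical of the trace form on derivations. -/
def PeRad (D : LieDerivation ℝ l l) : Prop :=
  ∀ ψ : LieDerivation ℝ l l, trace ℝ l ((D : l →ₗ[ℝ] l) ∘ₗ (ψ : l →ₗ[ℝ] l)) = 0

lemma PeRad.add {D E : LieDerivation ℝ l l} (hD : PeRad D) (hE : PeRad E) : PeRad (D + E) := by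
  intro ψ
  rw [LieDerivation.coe_add_linearMap, LinearMap.add_comp, map_add, hD, hE, add_zero]

lemma PeRad.smul {D : LieDerivation ℝ l l} (r : ℝ) (hD : PeRad D) : PeRad (r • D) := by
  intro ψ
  rw [LieDerivation.coe_smul_linearMap, LinearMap.smul_comp, map_smul, hD, smul_zero]

lemma PeRad.sub {D E : LieDerivation ℝ l l} (hD : PeRad D) (hE : PeRad E) : PeRad (D - E) := by
  intro ψ
  rw [LieDerivation.coe_sub_linearMap, LinearMap.sub_comp, map_sub, hD, hE, sub_zero]

lemma PeRad.zero : PeRad (0 : LieDerivation ℝ l l) := by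
  intro ψ
  rw [LieDerivation.coe_zero_linearMap, LinearMap.zero_comp, map_zero]

lemma PeRad.lie {D : LieDerivation ℝ l l} (E : LieDerivation ℝ l l) (hD : PeRad D) :
    PeRad ⁅E, D⁆ := by
  intro ψ
  have h := hD ⁅ψ, E⁆
  rw [LieDerivation.commutator_coe_linear_map, Ring.lie_def] at h ⊢
  rw [← Module.End.mul_eq_comp] at h ⊢
  rw [mul_sub, map_sub, sub_eq_zero] at h
  rw [sub_mul, map_sub, sub_eq_zero, mul_assoc, LinearMap.trace_mul_comm, mul_assoc, h, mul_assoc]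

lemma pe_sub_rad {φ ψ : LieDerivation ℝ l l} (h : IsPreEinstein φ) (h' : IsPreEinstein ψ) :
    PeRad (φ - ψ) := by
  intro η
  rw [LieDerivation.coe_sub_linearMap, LinearMap.sub_comp, map_sub, h.2, h'.2, sub_self]

/-- The radical as a Lie subalgebra of the endomorphisms. -/
def peSub (l : Type) [LieRing l] [LieAlgebra ℝ l] [FiniteDimensional ℝ l] :
    LieSubalgebra ℝ (Module.End ℝ l) where
  carrier := {f | ∃ D : LieDerivation ℝ l l, PeRad D ∧ (D : l →ₗ[ℝ] l) = f}
  add_mem' := by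
    rintro _ _ ⟨D, hD, rfl⟩ ⟨E, hE, rfl⟩
    exact ⟨D + E, hD.add hE, rfl⟩
  zero_mem' := ⟨0, PeRad.zero, rfl⟩
  smul_mem' := by
    rintro r _ ⟨D, hD, rfl⟩
    exact ⟨r • D, hD.smul r, rfl⟩
  lie_mem' := by
    rintro _ _ ⟨D, hD, rfl⟩ ⟨E, hE, rfl⟩
    exact ⟨⁅D, E⁆, hE.lie D, rfl⟩

lemma pe_flag (l : Type) [LieRing l] [LieAlgebra ℝ l] [FiniteDimensional ℝ l] :
    ∃ (V : ℕ → Submodule ℝ l) (K : ℕ), V 0 = ⊤ ∧ V K = ⊥ ∧ Antitone V ∧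
      (∀ D : LieDerivation ℝ l l, PeRad D → ∀ k, ∀ x ∈ V k, D x ∈ V (k + 1)) ∧
      (∀ D : LieDerivation ℝ l l, ∀ k, ∀ x ∈ V k, D x ∈ V k) := by
  have hnil : LieModule.IsNilpotent (peSub l) l := by
    rw [LieModule.isNilpotent_iff_forall (R := ℝ)]
    rintro ⟨_, D, hD, rfl⟩
    exact pe_real D hD
  obtain ⟨K, hK⟩ := (LieModule.isNilpotent_iff ℝ (peSub l) l).mp hnil
  refine ⟨fun k => (LieModule.lowerCentralSeries ℝ (peSub l) l k).toSubmodule, K, ?_, ?_, ?_, ?_, ?_⟩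
  · simp
  · simp [hK]
  · intro a b hab
    exact LieModule.antitone_lowerCentralSeries ℝ (peSub l) l hab
  · intro D hD k x hx
    beta_reduce
    rw [LieModule.lowerCentralSeries_succ]
    exact LieSubmodule.lie_mem_lie (x := (⟨_, D, hD, rfl⟩ : peSub l)) (LieSubmodule.mem_top _) hx
  · intro D k
    induction k with
    | zero => simp
    | succ k ih =>
      intro x hx
      beta_reduce at hx
      rw [LieModule.lowerCentralSeries_succ, LieSubmodule.lieIdeal_oper_eq_linear_span'] at hx
      induction hx using Submodule.span_induction with
      | zero => simp
      | add x y _ _ h h' => rw [map_add]; exact add_mem h h'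
      | smul r x _ h => rw [map_smul]; exact Submodule.smul_mem _ _ h
      | mem x hx =>
        obtain ⟨⟨_, E, hE, rfl⟩, -, y, hy, rfl⟩ := hx
        have h1 : ∀ E : LieDerivation ℝ l l, PeRad E → ∀ y ∈ LieModule.lowerCentralSeries ℝ (peSub l) l k,
            E y ∈ (LieModule.lowerCentralSeries ℝ (peSub l) l (k+1)).toSubmodule := by
          intro E hE y hy
          rw [LieModule.lowerCentralSeries_succ]
          exact LieSubmodule.lie_mem_lie (x := (⟨_, E, hE, rfl⟩ : peSub l)) (LieSubmodule.mem_top _) hy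
        change D (E y) ∈ _
        have h2 : D (E y) = ⁅D, E⁆ y + E (D y) := by
          rw [LieDerivation.commutator_apply]; abel
        rw [h2]
        exact add_mem (h1 _ (hE.lie D) _ hy) (h1 _ hE _ (ih _ hy))

/-- Conjugation of a derivation by an automorphism. -/
def peConj (σ : l ≃ₗ⁅ℝ⁆ l) (ψ : LieDerivation ℝ l l) : LieDerivation ℝ l l where
  toLinearMap := σ.toLinearEquiv.conj (ψ : l →ₗ[ℝ] l)
  leibniz' := fun a b => by
    change σ (ψ (σ.symm ⁅a, b⁆)) = ⁅a, σ (ψ (σ.symm b))⁆ - ⁅b, σ (ψ (σ.symm a))⁆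
    simp [LieEquiv.map_lie, LieDerivation.apply_lie_eq_sub]

lemma peConj_apply (σ : l ≃ₗ⁅ℝ⁆ l) (ψ : LieDerivation ℝ l l) (x : l) :
    peConj σ ψ x = σ (ψ (σ.symm x)) := rfl

lemma peConj_pre (σ : l ≃ₗ⁅ℝ⁆ l) {φ : LieDerivation ℝ l l} (h : IsPreEinstein φ) :
    IsPreEinstein (peConj σ φ) := by
  obtain ⟨⟨ι, b, hb⟩, h2⟩ := h
  refine ⟨⟨ι, b.map σ.toLinearEquiv, fun i => ?_⟩, fun ψ => ?_⟩
  · obtain ⟨μ, hμ⟩ := hb i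
    refine ⟨μ, ?_⟩
    change σ (φ (σ.symm (σ (b i)))) = μ • σ (b i)
    simp [hμ]
  · have h3 := h2 (peConj σ.symm ψ)
    have e1 : (peConj σ.symm ψ : l →ₗ[ℝ] l) = σ.toLinearEquiv.symm.conj (ψ : l →ₗ[ℝ] l) := rfl
    have e2 : (peConj σ φ : l →ₗ[ℝ] l) = σ.toLinearEquiv.conj (φ : l →ₗ[ℝ] l) := rfl
    rw [e1, LinearMap.trace_conj', ← LinearMap.trace_conj' _ σ.toLinearEquiv, LinearEquiv.conj_comp] at h3
    rw [← h3, e2]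
    congr 2
    ext x
    change ψ x = σ (σ.symm (ψ (σ (σ.symm x))))
    simp

/-- For a diagonalizable map, generalized eigenvectors are eigenvectors. -/
lemma pe_diag {ι : Type} (b : Basis ι ℝ l) (f : Module.End ℝ l)
    (hb : ∀ i, ∃ μ : ℝ, f (b i) = μ • b i) (μ : ℝ) (N : ℕ) (w : l)
    (h : ((f - μ • (1 : Module.End ℝ l)) ^ N) w = 0) : f w = μ • w := by
  choose m hm using hb
  have h1 : ∀ w i, b.repr ((f - μ • (1 : Module.End ℝ l)) w) i = (m i - μ) * b.repr w i := by
    intro w i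
    have : (b.coord i) ∘ₗ (f - μ • (1 : Module.End ℝ l)) = (m i - μ) • b.coord i := by
      apply b.ext
      intro j
      simp only [LinearMap.comp_apply, LinearMap.sub_apply, hm, LinearMap.smul_apply,
        Module.End.one_apply, map_sub, map_smul, Basis.coord_apply, Basis.repr_self, smul_eq_mul]
      by_cases hij : j = i
      · subst hij; ring
      · simp [hij]
    exact DFunLike.congr_fun this w
  have h2 : ∀ N w i, b.repr (((f - μ • (1 : Module.End ℝ l)) ^ N) w) i = (m i - μ) ^ N * b.repr w i := by
    intro N
    induction N with
    | zero => simp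
    | succ N ih => intro w i; rw [pow_succ, Module.End.mul_apply, ih, h1]; ring
  have h3 : (f - μ • (1 : Module.End ℝ l)) w = 0 := by
    apply b.repr.injective
    ext i
    have h4 := h2 N w i
    rw [h] at h4
    rw [h1]
    have h5 : (m i - μ) ^ N * b.repr w i = 0 := by rw [← h4]; simp
    rcases mul_eq_zero.mp h5 with h6 | h6
    · simp [eq_zero_of_pow_eq_zero h6]
    · simp [h6]
  simpa [sub_eq_zero] using h3

/-- Double commutation with a diagonalizable map is commutation. -/
lemma pe_comm {φ : LieDerivation ℝ l l} (h : IsPreEinstein φ) (x : LieDerivation ℝ l l)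
    (hx : ⁅φ, ⁅φ, x⁆⁆ = 0) : ⁅φ, x⁆ = 0 := by
  obtain ⟨⟨ι, b, hb⟩, -⟩ := h
  set y := ⁅φ, x⁆ with hy
  have h1 : ∀ v, φ (y v) = y (φ v) := fun v => by
    have := LieDerivation.congr_fun hx v
    rw [LieDerivation.commutator_apply] at this
    exact sub_eq_zero.mp this
  have h2 : (y : l →ₗ[ℝ] l) = 0 := by
    apply b.ext
    intro i
    obtain ⟨μ, hμ⟩ := hb i
    have h3 : y (b i) = φ (x (b i)) - μ • x (b i) := by
      rw [hy, LieDerivation.commutator_apply, hμ, map_smul]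
    have h4 : φ (x (b i)) = μ • x (b i) := by
      refine pe_diag b (φ : l →ₗ[ℝ] l) hb μ 2 (x (b i)) ?_
      have h5 : ((φ : l →ₗ[ℝ] l) - μ • (1 : Module.End ℝ l)) (x (b i)) = y (b i) := by
        rw [h3]; rfl
      rw [pow_two, Module.End.mul_apply, h5]
      change φ (y (b i)) - μ • y (b i) = 0
      rw [h1, hμ, map_smul, sub_self]
    change y (b i) = 0
    rw [h3, h4, sub_self]
  ext v
  exact LinearMap.congr_fun h2 v

/-- Commuting pre-Einstein derivations are equal. -/
lemma pe_eq {φ ψ : LieDerivation ℝ l l} (h : IsPreEinstein φ) (h' : IsPreEinstein ψ)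
    (hc : ⁅φ, ψ - φ⁆ = 0) : ψ = φ := by
  obtain ⟨N, hN⟩ := pe_real _ (pe_sub_rad h' h)
  obtain ⟨⟨ι, b, hb⟩, -⟩ := h
  obtain ⟨⟨ι', b', hb'⟩, -⟩ := h'
  suffices h2 : (ψ : l →ₗ[ℝ] l) = (φ : l →ₗ[ℝ] l) by
    ext v
    exact LinearMap.congr_fun h2 v
  apply b'.ext
  intro i
  obtain ⟨μ, hμ⟩ := hb' i
  change ψ (b' i) = φ (b' i)
  rw [hμ]
  symm
  refine pe_diag b (φ : l →ₗ[ℝ] l) hb μ N (b' i) ?_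
  set c := ψ - φ with hcdef
  have hcomm : ∀ v, φ (c v) = c (φ v) := fun v => by
    have := LieDerivation.congr_fun hc v
    rw [LieDerivation.commutator_apply] at this
    exact sub_eq_zero.mp this
  have hcm : Commute ((φ : l →ₗ[ℝ] l) - μ • (1 : Module.End ℝ l)) ((c : l →ₗ[ℝ] l) : Module.End ℝ l) := by
    ext v
    change φ (c v) - μ • c v = c (φ v - μ • v)
    rw [map_sub, map_smul, hcomm]
  have key : ∀ n : ℕ, (((φ : l →ₗ[ℝ] l) - μ • (1 : Module.End ℝ l)) ^ n) (b' i)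
      = ((-(c : l →ₗ[ℝ] l) : Module.End ℝ l) ^ n) (b' i) := by
    intro n
    induction n with
    | zero => rfl
    | succ n ih =>
      have h5 : ((φ : l →ₗ[ℝ] l) - μ • (1 : Module.End ℝ l)) (b' i) = (-(c : l →ₗ[ℝ] l)) (b' i) := by
        change φ (b' i) - μ • b' i = - (ψ (b' i) - φ (b' i))
        rw [hμ]; abel
      rw [pow_succ, Module.End.mul_apply, h5, ← Module.End.mul_apply,
        ((hcm.neg_right).pow_left n).eq, Module.End.mul_apply, ih, ← Module.End.mul_apply, ← pow_succ']
  rw [key, neg_pow, hN, mul_zero, LinearMap.zero_apply]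


/-- Endomorphisms shifting a filtration by `k`. -/
def peFil (V : ℕ → Submodule ℝ l) (k : ℕ) : Submodule ℝ (Module.End ℝ l) where
  carrier := {f | ∀ i, ∀ x ∈ V i, f x ∈ V (i + k)}
  add_mem' := fun hf hg i x hx => add_mem (hf i x hx) (hg i x hx)
  zero_mem' := fun i x _ => zero_mem _
  smul_mem' := fun r _ hf i x hx => Submodule.smul_mem _ r (hf i x hx)

lemma peFil_mul (V : ℕ → Submodule ℝ l) {a b : ℕ} {f g : Module.End ℝ l} (hf : f ∈ peFil V a)
    (hg : g ∈ peFil V b) : f * g ∈ peFil V (a + b) := by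
  intro i x hx
  have := hf _ _ (hg i x hx)
  rwa [add_assoc, add_comm b a] at this

lemma peFil_mono {V : ℕ → Submodule ℝ l} (hV : Antitone V) {a b : ℕ} (h : a ≤ b) :
    peFil V b ≤ peFil V a := fun _ hf i x hx => hV (by omega) (hf i x hx)

lemma peFil_one (V : ℕ → Submodule ℝ l) : (1 : Module.End ℝ l) ∈ peFil V 0 := fun _ _ hx => hx

lemma pe_pow {V : ℕ → Submodule ℝ l} (hV : Antitone V) {k : ℕ} (hk : 1 ≤ k)
    {η ψ : Module.End ℝ l} (hη : η ∈ peFil V k) (hc : η * ψ - ψ * η ∈ peFil V k) (m : ℕ) :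
    η ^ (m + 1) ∈ peFil V 1 ∧ η ^ (m + 1) * ψ - ψ * η ^ (m + 1) ∈ peFil V k ∧
      η ^ (m + 2) * ψ - ψ * η ^ (m + 2) ∈ peFil V (k + 1) := by
  have hη1 : η ∈ peFil V 1 := peFil_mono hV hk hη
  induction m with
  | zero =>
    refine ⟨by simpa using hη1, by simpa using hc, ?_⟩
    have : η ^ (0 + 2) * ψ - ψ * η ^ (0 + 2) = η * (η * ψ - ψ * η) + (η * ψ - ψ * η) * η := by
      noncomm_ring
    rw [this]
    refine add_mem ?_ (peFil_mul V hc hη1)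
    rw [add_comm k 1]
    exact peFil_mul V hη1 hc
  | succ m ih =>
    obtain ⟨h1, h2, h3⟩ := ih
    have h4 : η ^ (m + 1 + 1) ∈ peFil V 1 := by
      rw [pow_succ]
      exact peFil_mono hV (by omega) (peFil_mul V h1 hη1)
    refine ⟨h4, peFil_mono hV (by omega) h3, ?_⟩
    have : η ^ (m + 1 + 2) * ψ - ψ * η ^ (m + 1 + 2) =
        η * (η ^ (m + 2) * ψ - ψ * η ^ (m + 2)) + (η * ψ - ψ * η) * η ^ (m + 1 + 1) := by
      rw [show m + 1 + 2 = (m + 2) + 1 by ring, pow_succ' η (m + 2)]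
      noncomm_ring
    rw [this]
    exact add_mem (peFil_mono hV (by omega) (peFil_mul V hη1 h3)) (peFil_mul V hc h4)

lemma pe_exp (η : LieDerivation ℝ l l) (N : ℕ) (hN : ((η : l →ₗ[ℝ] l) : Module.End ℝ l) ^ N = 0) :
    ∃ σ : l ≃ₗ⁅ℝ⁆ l,
      (σ.toLinearEquiv : l →ₗ[ℝ] l) = ∑ i ∈ Finset.range N, ((i.factorial : ℝ)⁻¹) •
        ((η : l →ₗ[ℝ] l) : Module.End ℝ l) ^ i ∧
      (σ.symm.toLinearEquiv : l →ₗ[ℝ] l) = ∑ i ∈ Finset.range N, ((i.factorial : ℝ)⁻¹) •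
        (-((η : l →ₗ[ℝ] l) : Module.End ℝ l)) ^ i := by
  letI : Module ℚ l := Module.compHom l (algebraMap ℚ ℝ)
  have hq : ∀ (q : ℚ) (x : l), q • x = (q : ℝ) • x := fun q x => rfl
  letI : LieAlgebra ℚ l := { lie_smul := fun q x y => by simp [hq] }
  have hnil : IsNilpotent ((η : l →ₗ[ℝ] l) : Module.End ℝ l) := ⟨N, hN⟩
  have hN' : (-((η : l →ₗ[ℝ] l) : Module.End ℝ l)) ^ N = 0 := by rw [neg_pow, hN, mul_zero]
  refine ⟨LieDerivation.exp η hnil, ?_, ?_⟩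
  · ext x
    have : (LieDerivation.exp η hnil) x = IsNilpotent.exp ((η : l →ₗ[ℝ] l) : Module.End ℝ l) x := rfl
    rw [IsNilpotent.exp_eq_sum hN] at this
    refine this.trans ?_
    simp [LinearMap.sum_apply, hq]
  · ext x
    have : (LieDerivation.exp η hnil).symm x =
      IsNilpotent.exp (-((η : l →ₗ[ℝ] l) : Module.End ℝ l)) x := rfl
    rw [IsNilpotent.exp_eq_sum hN'] at this
    refine this.trans ?_
    simp [LinearMap.sum_apply, hq]

/-- Fitting-type decomposition for the adjoint action of a pre-Einstein derivation. -/
lemma pe_decomp {φ : LieDerivation ℝ l l} (h : IsPreEinstein φ)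
    (W : Submodule ℝ (LieDerivation ℝ l l)) (hW : ∀ x ∈ W, ⁅φ, x⁆ ∈ W)
    (n : LieDerivation ℝ l l) (hn : n ∈ W) :
    ∃ η ∈ W, ∃ n0 ∈ W, ⁅φ, n0⁆ = 0 ∧ n = n0 + ⁅φ, η⁆ := by
  let f : W →ₗ[ℝ] W := (LieAlgebra.ad ℝ (LieDerivation ℝ l l) φ).restrict hW
  have hf : ∀ x : W, (f x : LieDerivation ℝ l l) = ⁅φ, (x : LieDerivation ℝ l l)⁆ := fun x => rfl
  have hd : Disjoint (LinearMap.ker f) (LinearMap.range f) := by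
    rw [Submodule.disjoint_def]
    rintro _ h1 ⟨x, rfl⟩
    have h2 : ⁅φ, ⁅φ, (x : LieDerivation ℝ l l)⁆⁆ = 0 := by
      rw [← hf, ← hf, LinearMap.mem_ker.mp h1]; rfl
    apply Subtype.ext
    exact pe_comm h _ h2
  have ht : LinearMap.ker f ⊔ LinearMap.range f = ⊤ := by
    apply Submodule.eq_top_of_disjoint _ _ _ hd
    rw [add_comm, LinearMap.finrank_range_add_finrank_ker]
  have hm : (⟨n, hn⟩ : W) ∈ LinearMap.ker f ⊔ LinearMap.range f := ht ▸ Submodule.mem_top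
  obtain ⟨y, hy, _, ⟨x, rfl⟩, hxy⟩ := Submodule.mem_sup.mp hm
  refine ⟨x, x.2, y, y.2, ?_, ?_⟩
  · rw [← hf, LinearMap.mem_ker.mp hy]; rfl
  · exact (congrArg Subtype.val hxy).symm

lemma pe_step {V : ℕ → Submodule ℝ l} (hV : Antitone V)
    (hR : ∀ D : LieDerivation ℝ l l, PeRad D → (D : l →ₗ[ℝ] l) ∈ peFil V 1)
    (hS : ∀ D : LieDerivation ℝ l l, (D : l →ₗ[ℝ] l) ∈ peFil V 0)
    {φ ψ : LieDerivation ℝ l l} (hφ : IsPreEinstein φ) (hψ : IsPreEinstein ψ)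
    {k : ℕ} (hk : 1 ≤ k) (c : LieDerivation ℝ l l) (hc : PeRad c) (hφc : ⁅φ, c⁆ = 0)
    (hn : ((ψ - φ - c : LieDerivation ℝ l l) : l →ₗ[ℝ] l) ∈ peFil V k) :
    ∃ (σ : l ≃ₗ⁅ℝ⁆ l) (c' : LieDerivation ℝ l l), PeRad c' ∧ ⁅φ, c'⁆ = 0 ∧
      ((peConj σ ψ - φ - c' : LieDerivation ℝ l l) : l →ₗ[ℝ] l) ∈ peFil V (k + 1) := by
  let W : Submodule ℝ (LieDerivation ℝ l l) :=
    { carrier := {D | PeRad D ∧ (D : l →ₗ[ℝ] l) ∈ peFil V k}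
      add_mem' := fun hD hE => ⟨hD.1.add hE.1, add_mem hD.2 hE.2⟩
      zero_mem' := ⟨PeRad.zero, zero_mem _⟩
      smul_mem' := fun r _ hD => ⟨hD.1.smul r, Submodule.smul_mem _ r hD.2⟩ }
  have hW : ∀ x ∈ W, ⁅φ, x⁆ ∈ W := by
    rintro x ⟨h1, h2⟩
    refine ⟨h1.lie φ, ?_⟩
    rw [LieDerivation.commutator_coe_linear_map, Ring.lie_def]
    have a1 := peFil_mul V (hS φ) h2
    have a2 := peFil_mul V h2 (hS φ)
    rw [zero_add] at a1
    exact sub_mem a1 a2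
  obtain ⟨η, ⟨hη, hηk⟩, n0, ⟨hn0, hn0k⟩, hn0φ, hdec⟩ := pe_decomp hφ W hW (ψ - φ - c)
    ⟨(pe_sub_rad hψ hφ).sub hc, hn⟩
  obtain ⟨N, hN⟩ := pe_real η hη
  obtain ⟨σ, hσ, hσ'⟩ := pe_exp η (N + 2) (by rw [pow_add, hN, zero_mul])
  refine ⟨σ, c + n0, hc.add hn0, by rw [lie_add, hφc, hn0φ, add_zero], ?_⟩
  set H : Module.End ℝ l := (η : l →ₗ[ℝ] l) with hH
  set P : Module.End ℝ l := (ψ : l →ₗ[ℝ] l) with hP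
  set F : Module.End ℝ l := (φ : l →ₗ[ℝ] l) with hF
  set C : Module.End ℝ l := (c : l →ₗ[ℝ] l) with hC
  set Q : Module.End ℝ l := (n0 : l →ₗ[ℝ] l) with hQ
  set S : Module.End ℝ l := (σ.toLinearEquiv : l →ₗ[ℝ] l) with hSdef
  set T : Module.End ℝ l := (σ.symm.toLinearEquiv : l →ₗ[ℝ] l) with hTdef
  have hdec' : P - F - C = Q + (F * H - H * F) := congrArg (fun D : LieDerivation ℝ l l => (D : l →ₗ[ℝ] l)) hdec
  have hST : S * T = 1 := by
    ext x
    change σ (σ.symm x) = x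
    simp
  have hgoal : ((peConj σ ψ - φ - (c + n0) : LieDerivation ℝ l l) : l →ₗ[ℝ] l)
      = S * P * T - F - (C + Q) := rfl
  rw [hgoal]
  have hH1 : H ∈ peFil V 1 := peFil_mono hV hk hηk
  have hPk : P - F - C ∈ peFil V k := hn
  have hP1 : P - F ∈ peFil V 1 := hR _ (pe_sub_rad hψ hφ)
  -- the commutator modulo `k + 1`
  have hHPF : H * (P - F) - (P - F) * H ∈ peFil V (k + 1) := by
    have a2 := peFil_mul V hP1 hηk
    rw [add_comm] at a2
    exact sub_mem (peFil_mul V hηk hP1) a2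
  have hHP : H * P - P * H ∈ peFil V k := by
    have a1 := peFil_mul V hηk (hS ψ)
    have a2 := peFil_mul V (hS ψ) hηk
    rw [zero_add] at a2
    exact sub_mem a1 a2
  have hpow := pe_pow hV hk hηk hHP
  have hT0 : T - 1 ∈ peFil V 1 := by
    rw [hσ', Finset.sum_range_succ']
    simp only [Nat.factorial_zero, Nat.cast_one, inv_one, pow_zero, one_smul, add_sub_cancel_right]
    refine Submodule.sum_mem _ fun i _ => Submodule.smul_mem _ _ ?_
    rw [neg_pow, show ((-1 : Module.End ℝ l) ^ (i + 1)) * H ^ (i + 1) = ((-1 : ℝ) ^ (i + 1)) • H ^ (i + 1) by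
      rcases neg_one_pow_eq_or ℝ (i + 1) with h | h <;>
      rcases Nat.even_or_odd (i + 1) with h' | h' <;> simp [h'.neg_one_pow]]
    exact Submodule.smul_mem _ _ (hpow i).1
  have hTT : T ∈ peFil V 0 := by
    have := add_mem (peFil_mono hV (Nat.zero_le 1) hT0) (peFil_one V)
    simpa using this
  have hSP : (S * P - P * S) - (H * P - P * H) ∈ peFil V (k + 1) := by
    have hS2 : S = ∑ i ∈ Finset.range N, (((i + 2).factorial : ℝ)⁻¹) • H ^ (i + 2) + H + 1 := by
      rw [hσ, Finset.sum_range_succ', Finset.sum_range_succ']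
      simp
    have : (S * P - P * S) - (H * P - P * H) =
        ∑ i ∈ Finset.range N, (((i + 2).factorial : ℝ)⁻¹) • (H ^ (i + 2) * P - P * H ^ (i + 2)) := by
      simp only [smul_sub, Finset.sum_sub_distrib]
      rw [hS2]
      simp only [add_mul, mul_add, Finset.sum_mul, Finset.mul_sum, one_mul, mul_one,
        smul_mul_assoc, mul_smul_comm]
      abel
    rw [this]
    exact Submodule.sum_mem _ fun i _ => Submodule.smul_mem _ _ (hpow i).2.2
  have hfinal : S * P * T - F - (C + Q) =
      ((S * P - P * S) - (H * P - P * H)) * T + (H * P - P * H) * (T - 1)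
      + (H * (P - F) - (P - F) * H) := by
    have e1 : P * S * T = P := by rw [mul_assoc, hST, mul_one]
    have e2 : Q = P - F - C - (F * H - H * F) := by rw [hdec']; abel
    have e3 : ((S * P - P * S) - (H * P - P * H)) * T + (H * P - P * H) * (T - 1)
      + (H * (P - F) - (P - F) * H) = S * P * T - P * S * T + (F * H - H * F) := by
      noncomm_ring
    rw [e3, e1, e2]
    abel
  rw [hfinal]
  have hA := peFil_mul V hSP hTT
  rw [add_zero] at hA
  exact add_mem (add_mem hA (peFil_mul V hHP hT0)) hHPF

end pePart

/-- A pre-Einstein derivation is unique up to an automorphism of the Lie algebra. -/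
theorem preEinstein_unique_up_to_aut (l : Type) [LieRing l] [LieAlgebra ℝ l]
    [FiniteDimensional ℝ l] (φ₁ φ₂ : LieDerivation ℝ l l)
    (h₁ : IsPreEinstein φ₁) (h₂ : IsPreEinstein φ₂) :
    ∃ σ : l ≃ₗ⁅ℝ⁆ l, ∀ x : l, φ₂ x = σ (φ₁ (σ.symm x)) := by
  obtain ⟨V, K, hV0, hVK, hV, hR, hS⟩ := pe_flag l
  have key : ∀ k : ℕ, ∃ (σ : l ≃ₗ⁅ℝ⁆ l) (c : LieDerivation ℝ l l), PeRad c ∧ ⁅φ₁, c⁆ = 0 ∧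
      ((peConj σ φ₂ - φ₁ - c : LieDerivation ℝ l l) : l →ₗ[ℝ] l) ∈ peFil V (k + 1) := by
    intro k
    induction k with
    | zero =>
      refine ⟨LieEquiv.refl, 0, PeRad.zero, lie_zero _, ?_⟩
      have : peConj LieEquiv.refl φ₂ - φ₁ - 0 = φ₂ - φ₁ := by
        rw [sub_zero]; rfl
      rw [this]
      exact hR _ (pe_sub_rad h₂ h₁)
    | succ k ih =>
      obtain ⟨σ, c, hc, hφc, hn⟩ := ih
      obtain ⟨τ, c', hc', hφc', hn'⟩ := pe_step hV hR hS h₁ (peConj_pre σ h₂) (Nat.le_add_left 1 k)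
        c hc hφc hn
      exact ⟨σ.trans τ, c', hc', hφc', hn'⟩
  obtain ⟨σ, c, hc, hφc, hn⟩ := key K
  have hz : peConj σ φ₂ - φ₁ = c := by
    ext x
    have h3 := hn 0 x (hV0 ▸ Submodule.mem_top)
    have h4 := hV (show K ≤ 0 + (K + 1) by omega) h3
    rw [hVK, Submodule.mem_bot] at h4
    exact sub_eq_zero.mp h4
  have he := pe_eq h₁ (peConj_pre σ h₂) (by rw [hz]; exact hφc)
  refine ⟨σ.symm, fun x => ?_⟩
  rw [← he, peConj_apply]
  simp
end

section
/- Let (l,⟨·,·⟩) be a metric Lie algebra and let ψ be a derivation of l that is semisimple with all eigenvalues real; let λ1 < … < λm be its eigenvalues and n_1, …, n_m the corresponding eigenspaces. Define the symmetric endomorphism ψ⊥ of l by ψ⊥ = λ_i · id on W_i := (n_i ⊕ … ⊕ n_m) ∩ (n_{i+1} ⊕ … ⊕ n_m)^⊥ for i = 1, …, m (so l is the orthogonal direct sum of the W_i). Then Ξ(ψ⊥, id) ≤ 0, with equality if and only if ψ⊥ is a derivation of l. -/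
open LieAlgebra Module LinearMap

/-- A raw inner product on a real vector space: symmetric, bilinear, positive definite. -/
def IsInnerProduct (g : Type*) [AddCommGroup g] [Module ℝ g] (ip : g → g → ℝ) : Prop :=
  (∀ X Y : g, ip X Y = ip Y X) ∧
  (∀ (a : ℝ) (X X' Y : g), ip (a • X + X') Y = a * ip X Y + ip X' Y) ∧
  (∀ X : g, X ≠ 0 → 0 < ip X X)

/-- A basis is orthonormal with respect to a raw inner product. -/
def IsONB {g : Type*} [AddCommGroup g] [Module ℝ g] {ι : Type}
    (ip : g → g → ℝ) (E : Basis ι ℝ g) : Prop :=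
  ∀ i j, (i = j → ip (E i) (E j) = 1) ∧ (i ≠ j → ip (E i) (E j) = 0)

/-- The coboundary-type bilinear form `Ξ(A₁, A₂) = ⟨δ(A₁), δ(A₂)⟩`, computed in an
orthonormal basis `E`, where `δ(A)(X,Y) = -A[X,Y] + [AX,Y] + [X,AY]`. -/
noncomputable def XiForm {l : Type*} [LieRing l] [LieAlgebra ℝ l] {ι : Type} [Fintype ι]
    (ip : l → l → ℝ) (E : Basis ι ℝ l) (A₁ A₂ : l →ₗ[ℝ] l) : ℝ :=
  ∑ i, ∑ j,
    ip (-(A₁ ⁅E i, E j⁆) + ⁅A₁ (E i), E j⁆ + ⁅E i, A₁ (E j)⁆)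
       (-(A₂ ⁅E i, E j⁆) + ⁅A₂ (E i), E j⁆ + ⁅E i, A₂ (E j)⁆)

open scoped InnerProductSpace

section XiAux

variable {V : Type} [NormedAddCommGroup V] [InnerProductSpace ℝ V]

lemma xi_trace_onb {ι κ : Type} [Fintype ι] [Fintype κ] (E : OrthonormalBasis ι ℝ V)
    (F : OrthonormalBasis κ ℝ V) (G : V →ₗ[ℝ] V →ₗ[ℝ] ℝ) :
    ∑ i, G (E i) (E i) = ∑ a, G (F a) (F a) := by
  have h1 : ∀ i, G (E i) (E i) = ∑ a, ⟪F a, E i⟫_ℝ * G (F a) (E i) := by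
    intro i
    conv_lhs => rw [show G (E i) = G (∑ a, ⟪F a, E i⟫_ℝ • F a) by rw [F.sum_repr' (E i)]]
    simp [LinearMap.sum_apply]
  have h2 : ∀ a, G (F a) (F a) = ∑ i, ⟪F a, E i⟫_ℝ * G (F a) (E i) := by
    intro a
    conv_lhs => rw [show G (F a) (F a) = G (F a) (∑ i, ⟪E i, F a⟫_ℝ • E i) by
      rw [E.sum_repr' (F a)]]
    simp [real_inner_comm]
  simp_rw [h1, h2]
  exact Finset.sum_comm

lemma xi_trace2_onb {ι κ : Type} [Fintype ι] [Fintype κ] (E : OrthonormalBasis ι ℝ V)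
    (F : OrthonormalBasis κ ℝ V) (A B : V →ₗ[ℝ] V →ₗ[ℝ] V) :
    ∑ i, ∑ j, ⟪A (E i) (E j), B (E i) (E j)⟫_ℝ
      = ∑ a, ∑ b, ⟪A (F a) (F b), B (F a) (F b)⟫_ℝ := by
  have h1 : ∀ i, ∑ j, ⟪A (E i) (E j), B (E i) (E j)⟫_ℝ
      = ∑ b, ⟪A (E i) (F b), B (E i) (F b)⟫_ℝ := fun i =>
    xi_trace_onb E F ((innerₗ V).compl₁₂ (A (E i)) (B (E i)))
  have h2 : ∀ b, ∑ i, ⟪A (E i) (F b), B (E i) (F b)⟫_ℝ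
      = ∑ a, ⟪A (F a) (F b), B (F a) (F b)⟫_ℝ := fun b =>
    xi_trace_onb E F ((innerₗ V).compl₁₂ (A.flip (F b)) (B.flip (F b)))
  simp_rw [h1]
  rw [Finset.sum_comm]
  simp_rw [h2]
  exact Finset.sum_comm

/-- the sum of the eigenspaces with eigenvalue at least `t` -/
def xiS {m : ℕ} (ψ : V →ₗ[ℝ] V) (lam : Fin m → ℝ) (t : ℝ) : Submodule ℝ V :=
  ⨆ j, ⨆ _ : t ≤ lam j, Module.End.eigenspace ψ (lam j)

/-- the sum of the eigenspaces with eigenvalue greater than `t` -/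
def xiT {m : ℕ} (ψ : V →ₗ[ℝ] V) (lam : Fin m → ℝ) (t : ℝ) : Submodule ℝ V :=
  ⨆ j, ⨆ _ : t < lam j, Module.End.eigenspace ψ (lam j)

lemma xiS_le_xiT {m : ℕ} (ψ : V →ₗ[ℝ] V) (lam : Fin m → ℝ) {s t : ℝ} (h : s < t) :
    xiS ψ lam t ≤ xiT ψ lam s :=
  iSup_le fun j => iSup_le fun hj => le_iSup₂_of_le j (h.trans_le hj) le_rfl

lemma xiT_le_xiS {m : ℕ} (ψ : V →ₗ[ℝ] V) (lam : Fin m → ℝ) (t : ℝ) :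
    xiT ψ lam t ≤ xiS ψ lam t :=
  iSup_le fun j => iSup_le fun hj => le_iSup₂_of_le j hj.le le_rfl

lemma xi_eig_le_xiS {m : ℕ} (ψ : V →ₗ[ℝ] V) (lam : Fin m → ℝ) (j : Fin m) :
    Module.End.eigenspace ψ (lam j) ≤ xiS ψ lam (lam j) := by
  unfold xiS
  exact le_iSup₂_of_le (f := fun i (_ : lam j ≤ lam i) => Module.End.eigenspace ψ (lam i))
    j (le_refl (lam j)) (le_refl _)

lemma xi_bracket {m : ℕ} (ψ : V →ₗ[ℝ] V) (lam : Fin m → ℝ) (B : V →ₗ[ℝ] V →ₗ[ℝ] V)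
    (hder : ∀ x y, ψ (B x y) = B (ψ x) y + B x (ψ y))
    (heigall : ∀ μ : ℝ, Module.End.HasEigenvalue ψ μ → ∃ i, μ = lam i) (s t : ℝ) (x y : V)
    (hx : x ∈ xiS ψ lam s) (hy : y ∈ xiS ψ lam t) : B x y ∈ xiS ψ lam (s + t) := by
  have key : Submodule.map₂ B (xiS ψ lam s) (xiS ψ lam t) ≤ xiS ψ lam (s + t) := by
    conv_lhs => unfold xiS
    simp only [Submodule.map₂_iSup_left, Submodule.map₂_iSup_right]
    refine iSup_le fun j => iSup_le fun hj => iSup_le fun k => iSup_le fun hk => ?_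
    rw [Submodule.map₂_le]
    intro x hx y hy
    rw [Module.End.mem_eigenspace_iff] at hx hy
    have h : ψ (B x y) = (lam j + lam k) • B x y := by
      rw [hder, hx, hy]; simp [add_smul, add_comm]
    by_cases h0 : B x y = 0
    · rw [h0]; exact zero_mem _
    · obtain ⟨i, hi⟩ := heigall (lam j + lam k)
        (Module.End.hasEigenvalue_of_hasEigenvector ⟨Module.End.mem_eigenspace_iff.2 h, h0⟩)
      have : Module.End.eigenspace ψ (lam i) ≤ xiS ψ lam (s + t) :=
        le_iSup₂_of_le i (by linarith) le_rfl
      exact this (Module.End.mem_eigenspace_iff.2 (hi ▸ h))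
  exact key (Submodule.apply_mem_map₂ B hx hy)

variable [FiniteDimensional ℝ V]

lemma xi_subordinate {m : ℕ} (W : Fin m → Submodule ℝ V)
    (horth : OrthogonalFamily ℝ (fun i => W i) fun i => (W i).subtypeₗᵢ) (htop : iSup W = ⊤) :
    ∃ (n : ℕ) (F : OrthonormalBasis (Fin n) ℝ V) (c : Fin n → Fin m), ∀ a, F a ∈ W (c a) := by
  have hint : DirectSum.IsInternal W := by
    refine horth.isInternal_iff.2 ?_
    rw [htop, Submodule.top_orthogonal_eq_bot]
  exact ⟨_, hint.subordinateOrthonormalBasis rfl horth,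
    fun a => hint.subordinateOrthonormalBasisIndex rfl a horth,
    fun a => hint.subordinateOrthonormalBasis_subordinate rfl a horth⟩

lemma xi_exists_basis {m : ℕ} (ψ : V →ₗ[ℝ] V) (lam : Fin m → ℝ) (hlam : StrictMono lam)
    (hdiag : (⨆ i, Module.End.eigenspace ψ (lam i)) = ⊤) :
    ∃ (n : ℕ) (F : OrthonormalBasis (Fin n) ℝ V) (c : Fin n → Fin m),
      ∀ a, F a ∈ xiS ψ lam (lam (c a)) ⊓ (xiT ψ lam (lam (c a)))ᗮ := by
  classical
  set W : Fin m → Submodule ℝ V := fun i => xiS ψ lam (lam i) ⊓ (xiT ψ lam (lam i))ᗮ with hW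
  have horth' : ∀ i j, i < j → W i ⟂ W j := by
    intro i j hij
    refine (Submodule.isOrtho_iff_le.2 ?_).symm
    refine (inf_le_left.trans (xiS_le_xiT ψ lam (hlam hij))).trans ?_
    refine (Submodule.le_orthogonal_orthogonal _).trans (Submodule.orthogonal_le inf_le_right)
  have horth : OrthogonalFamily ℝ (fun i => W i) fun i => (W i).subtypeₗᵢ := by
    refine OrthogonalFamily.of_pairwise ?_
    intro i j hij
    rcases lt_or_gt_of_ne hij with h | h
    · exact horth' i j h
    · exact (horth' j i h).symm
  have htop : iSup W = ⊤ := by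
    have hn : ∀ k : ℕ, ∀ j : Fin m, m - j ≤ k → Module.End.eigenspace ψ (lam j) ≤ iSup W := by
      intro k
      induction k with
      | zero => intro j hj; have := j.2; omega
      | succ k ih =>
        intro j hj
        have hT : xiT ψ lam (lam j) ≤ iSup W := by
          refine iSup_le fun i => iSup_le fun hi => ih i ?_
          have : (j : ℕ) < i := hlam.lt_iff_lt.1 hi
          omega
        have hS : xiS ψ lam (lam j) ≤ iSup W := by
          rw [← Submodule.sup_orthogonal_inf_of_hasOrthogonalProjection
            (xiT_le_xiS ψ lam (lam j))]
          refine sup_le hT ?_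
          rw [inf_comm]
          exact le_iSup W j
        exact (xi_eig_le_xiS ψ lam j).trans hS
    rw [eq_top_iff, ← hdiag]
    exact iSup_le fun j => hn _ j le_rfl
  exact xi_subordinate W horth htop

lemma xi_term {n : ℕ} (F : OrthonormalBasis (Fin n) ℝ V) (μ : Fin n → ℝ) (P : V →ₗ[ℝ] V)
    (hP : ∀ a, P (F a) = μ a • F a) (s : ℝ) (v : V)
    (hv : ∀ a, μ a < s → ⟪F a, v⟫_ℝ = 0) :
    ⟪-(P v) + s • v, v⟫_ℝ ≤ 0 ∧ (⟪-(P v) + s • v, v⟫_ℝ = 0 → P v = s • v) := by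
  have h1 : -(P v) + s • v = ∑ a, ((s - μ a) * ⟪F a, v⟫_ℝ) • F a := by
    conv_lhs => rw [← F.sum_repr' v]
    simp only [map_sum, map_smul, hP, Finset.smul_sum, ← Finset.sum_neg_distrib,
      ← Finset.sum_add_distrib]
    refine Finset.sum_congr rfl fun a _ => ?_
    module
  have h2 : ⟪-(P v) + s • v, v⟫_ℝ = ∑ a, (s - μ a) * ⟪F a, v⟫_ℝ ^ 2 := by
    rw [h1, sum_inner]
    refine Finset.sum_congr rfl fun a _ => ?_
    rw [real_inner_smul_left]; ring
  have h3 : ∀ a, (s - μ a) * ⟪F a, v⟫_ℝ ^ 2 ≤ 0 := by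
    intro a
    rcases lt_or_ge (μ a) s with h | h
    · simp [hv a h]
    · exact mul_nonpos_of_nonpos_of_nonneg (by linarith) (sq_nonneg _)
  refine ⟨h2 ▸ Finset.sum_nonpos fun a _ => h3 a, fun h => ?_⟩
  rw [h2, Finset.sum_eq_zero_iff_of_nonpos fun a _ => h3 a] at h
  have h4 : -(P v) + s • v = 0 := by
    rw [h1]
    refine Finset.sum_eq_zero fun a ha => ?_
    have := h a ha
    rcases mul_eq_zero.1 this with h | h
    · simp [h]
    · simp [pow_eq_zero_iff (two_ne_zero)] at h
      simp [h]
  rw [neg_add_eq_zero] at h4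
  exact h4

theorem xi_abstract (B : V →ₗ[ℝ] V →ₗ[ℝ] V) (ψ : V →ₗ[ℝ] V)
    (hder : ∀ x y, ψ (B x y) = B (ψ x) y + B x (ψ y)) (m : ℕ) (lam : Fin m → ℝ)
    (hlam : StrictMono lam)
    (heigall : ∀ μ : ℝ, Module.End.HasEigenvalue ψ μ → ∃ i, μ = lam i)
    (hdiag : (⨆ i, Module.End.eigenspace ψ (lam i)) = ⊤)
    (P : V →ₗ[ℝ] V)
    (hP : ∀ (i : Fin m) (x : V),
      x ∈ (⨆ j, ⨆ _ : i ≤ j, Module.End.eigenspace ψ (lam j)) →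
      (∀ y ∈ (⨆ j, ⨆ _ : i < j, Module.End.eigenspace ψ (lam j)), ⟪x, y⟫_ℝ = 0) →
      P x = lam i • x)
    {ι : Type} [Fintype ι] (E : OrthonormalBasis ι ℝ V) :
    (∑ i, ∑ j, ⟪-(P (B (E i) (E j))) + B (P (E i)) (E j) + B (E i) (P (E j)),
        B (E i) (E j)⟫_ℝ) ≤ 0 ∧
    ((∑ i, ∑ j, ⟪-(P (B (E i) (E j))) + B (P (E i)) (E j) + B (E i) (P (E j)),
        B (E i) (E j)⟫_ℝ) = 0 ↔ ∀ X Y, P (B X Y) = B (P X) Y + B X (P Y)) := by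
  obtain ⟨n, F, c, hF⟩ := xi_exists_basis ψ lam hlam hdiag
  have hPF : ∀ a, P (F a) = lam (c a) • F a := by
    intro a
    have h1 : F a ∈ xiS ψ lam (lam (c a)) := (hF a).1
    have h2 : F a ∈ (xiT ψ lam (lam (c a)))ᗮ := (hF a).2
    refine hP (c a) (F a) ?_ ?_
    · simpa only [xiS, hlam.le_iff_le] using h1
    · intro y hy
      rw [real_inner_comm]
      refine (Submodule.mem_orthogonal _ _).1 h2 y ?_
      simpa only [xiT, hlam.lt_iff_lt] using hy
  set D : V →ₗ[ℝ] V →ₗ[ℝ] V := -(B.compr₂ P) + B ∘ₗ P + B.compl₂ P with hD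
  have hDa : ∀ x y, D x y = -(P (B x y)) + B (P x) y + B x (P y) := fun x y => rfl
  simp_rw [← hDa]
  rw [xi_trace2_onb E F D B]
  have hDF : ∀ a b, D (F a) (F b)
      = -(P (B (F a) (F b))) + (lam (c a) + lam (c b)) • B (F a) (F b) := by
    intro a b
    rw [hDa, hPF, hPF]
    simp [add_smul, add_assoc]
  have hterm : ∀ a b, ⟪D (F a) (F b), B (F a) (F b)⟫_ℝ ≤ 0 ∧
      (⟪D (F a) (F b), B (F a) (F b)⟫_ℝ = 0 → D (F a) (F b) = 0) := by
    intro a b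
    have hmem := xi_bracket ψ lam B hder heigall _ _ _ _ (hF a).1 (hF b).1
    have := xi_term F (fun a => lam (c a)) P hPF (lam (c a) + lam (c b)) (B (F a) (F b))
      (fun d hd => by
        rw [real_inner_comm]
        exact (Submodule.mem_orthogonal _ _).1 (hF d).2 _ (xiS_le_xiT ψ lam hd hmem))
    rw [hDF]
    exact ⟨this.1, fun h => by rw [this.2 h]; simp⟩
  have hrow : ∀ a, ∑ b, ⟪D (F a) (F b), B (F a) (F b)⟫_ℝ ≤ 0 := fun a =>
    Finset.sum_nonpos fun b _ => (hterm a b).1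
  refine ⟨Finset.sum_nonpos fun a _ => hrow a, fun h => ?_, fun h => ?_⟩
  · rw [Finset.sum_eq_zero_iff_of_nonpos fun a _ => hrow a] at h
    have hz : D = 0 := by
      refine F.toBasis.ext fun a => F.toBasis.ext fun b => ?_
      have h2 := h a (Finset.mem_univ a)
      rw [Finset.sum_eq_zero_iff_of_nonpos fun b _ => (hterm a b).1] at h2
      simpa using (hterm a b).2 (h2 b (Finset.mem_univ b))
    intro X Y
    have h3 := hDa X Y
    rw [hz, add_assoc] at h3
    exact (neg_add_eq_zero.1 h3.symm)
  · refine Finset.sum_eq_zero fun a _ => Finset.sum_eq_zero fun b _ => ?_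
    rw [hDa, h]
    simp [add_assoc]

end XiAux

/-- Lemma 3.2 (1): for a real semisimple derivation `ψ` with eigenvalues `λ₁ < … < λ_m`, the
associated symmetric operator `ψ⊥` satisfies `Ξ(ψ⊥, id) ≤ 0`, with equality if and only if
`ψ⊥` is a derivation. -/
theorem xi_psi_perp_nonpos (l : Type) [LieRing l] [LieAlgebra ℝ l] [FiniteDimensional ℝ l]
    (ip : l → l → ℝ) (hip : IsInnerProduct l ip)
    (ψ : LieDerivation ℝ l l) (m : ℕ) (lam : Fin m → ℝ) (hlam : StrictMono lam)
    (heig : ∀ i, Module.End.HasEigenvalue (ψ : l →ₗ[ℝ] l) (lam i))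
    (heigall : ∀ μ : ℝ, Module.End.HasEigenvalue (ψ : l →ₗ[ℝ] l) μ → ∃ i, μ = lam i)
    (hdiag : (⨆ i, Module.End.eigenspace (ψ : l →ₗ[ℝ] l) (lam i)) = ⊤)
    (P : l →ₗ[ℝ] l)
    (hP : ∀ (i : Fin m) (x : l),
      x ∈ (⨆ j, ⨆ _ : i ≤ j, Module.End.eigenspace (ψ : l →ₗ[ℝ] l) (lam j)) →
      (∀ y ∈ (⨆ j, ⨆ _ : i < j, Module.End.eigenspace (ψ : l →ₗ[ℝ] l) (lam j)), ip x y = 0) →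
      P x = lam i • x) :
    ∀ (ι : Type) (_ : Fintype ι) (E : Basis ι ℝ l), IsONB ip E →
      XiForm ip E P LinearMap.id ≤ 0 ∧
        (XiForm ip E P LinearMap.id = 0 ↔ ∀ X Y : l, P ⁅X, Y⁆ = ⁅P X, Y⁆ + ⁅X, P Y⁆) := by
  intro ι _ E hE
  obtain ⟨hsymm, hlin, hpos⟩ := hip
  have hz : ∀ Y, ip 0 Y = 0 := by
    intro Y
    have := hlin 1 0 0 Y
    simp at this
    exact this
  have hadd : ∀ X X' Y, ip (X + X') Y = ip X Y + ip X' Y := by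
    intro X X' Y
    simpa using hlin 1 X X' Y
  have hsmul : ∀ (a : ℝ) X Y, ip (a • X) Y = a * ip X Y := by
    intro a X Y
    simpa [hz] using hlin a X 0 Y
  let core : InnerProductSpace.Core ℝ l :=
    { inner := ip
      conj_inner_symm := fun x y => hsymm y x
      re_inner_nonneg := fun x => by
        by_cases h : x = 0
        · subst h; exact (hz 0).ge
        · exact (hpos x h).le
      add_left := hadd
      smul_left := fun x y r => hsmul r x y
      definite := fun x hx => by
        by_contra h
        exact (hpos x h).ne' hx }
  letI i1 : NormedAddCommGroup l := core.toNormedAddCommGroup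
  letI i2 : InnerProductSpace ℝ l := InnerProductSpace.ofCore core.toCore
  have hon : Orthonormal ℝ E := by
    classical
    rw [orthonormal_iff_ite]
    intro i j
    split_ifs with h
    · exact (hE i j).1 h
    · exact (hE i j).2 h
  have main := xi_abstract (V := l) (LieModule.toEnd ℝ l l : l →ₗ[ℝ] l →ₗ[ℝ] l)
    (ψ : l →ₗ[ℝ] l) (fun x y => by
      change ψ ⁅x, y⁆ = ⁅ψ x, y⁆ + ⁅x, ψ y⁆
      rw [LieDerivation.apply_lie_eq_add, add_comm]) m lam hlam heigall hdiag P hP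
    (E.toOrthonormalBasis hon)
  have hX : XiForm ip E P LinearMap.id = ∑ i, ∑ j,
      ip (-(P ⁅E i, E j⁆) + ⁅P (E i), E j⁆ + ⁅E i, P (E j)⁆) ⁅E i, E j⁆ := by
    simp only [XiForm, LinearMap.id_apply, neg_add_cancel, zero_add]
  rw [hX]
  simp only [Basis.coe_toOrthonormalBasis] at main
  exact main
end
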